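/- arXiv:1903.08033 — 9 statements merged into one kernel-verified Lean document; each statement's English description precedes it below -/
import Mathlib

section
/- Let α > 0 and H ∈ (1/2, 1) be real numbers. There exists a constant C > 0 such that for all t > 0, ∫₀^t e^{α u} u^{2H−2} du ≤ C · t^{2H−2} e^{α t}. -/
open MeasureTheory Real

/-- For `p ≤ 0`, one of the two factors of `exp (α * u) * u ^ p` is controlled by its value at
`t / 2`, according to whether `u` lies to the left or to the right of `t / 2`. -/
lemma exp_mul_rpow_le_add {α p t u : ℝ} (hα : 0 ≤ α) (hp : p ≤ 0) (ht : 0 < t) (hu : 0 < u) :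
    exp (α * u) * u ^ p ≤ exp (α * u) * (t / 2) ^ p + exp (α * (t / 2)) * u ^ p := by
  rcases le_total u (t / 2) with h | h
  · have : exp (α * u) * u ^ p ≤ exp (α * (t / 2)) * u ^ p := by gcongr
    have : 0 ≤ exp (α * u) * (t / 2) ^ p := by positivity
    linarith
  · have : exp (α * u) * u ^ p ≤ exp (α * u) * (t / 2) ^ p :=
      mul_le_mul_of_nonneg_left (rpow_le_rpow_of_nonpos (by positivity) h hp) (exp_pos _).le
    have : 0 ≤ exp (α * (t / 2)) * u ^ p := by positivity
    linarith

lemma integral_exp_mul_rpow_le {α p t : ℝ} (hα : 0 < α) (hp : -1 < p) (hp' : p ≤ 0) (ht : 0 < t) :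
    ∫ u in (0 : ℝ)..t, exp (α * u) * u ^ p
      ≤ ((1 / 2) ^ p / α + 2 / (α * (p + 1))) * t ^ p * exp (α * t) := by
  have hp1 : 0 < p + 1 := by linarith
  have hrpow : IntervalIntegrable (fun u : ℝ => u ^ p) volume 0 t :=
    intervalIntegral.intervalIntegrable_rpow' hp
  have hexp : Continuous fun u : ℝ => exp (α * u) := by fun_prop
  have hleft : IntervalIntegrable (fun u => exp (α * u) * (t / 2) ^ p) volume 0 t :=
    (hexp.mul continuous_const).intervalIntegrable _ _
  have hright : IntervalIntegrable (fun u => exp (α * (t / 2)) * u ^ p) volume 0 t :=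
    hrpow.const_mul _
  have hint_exp : ∫ u in (0 : ℝ)..t, exp (α * u) = (exp (α * t) - 1) / α := by
    rw [intervalIntegral.integral_comp_mul_left (fun x => exp x) hα.ne', integral_exp]
    simp [div_eq_inv_mul]
  have hint_rpow : ∫ u in (0 : ℝ)..t, u ^ p = t ^ p * t / (p + 1) := by
    rw [integral_rpow (Or.inl hp), zero_rpow hp1.ne', sub_zero, rpow_add_one ht.ne']
  have hsplit : exp (α * t) = exp (α * (t / 2)) * exp (α * (t / 2)) := by
    rw [← exp_add]
    ring_nf
  have hhalf : (t / 2) ^ p = (1 / 2) ^ p * t ^ p := by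
    rw [← mul_rpow (by norm_num) ht.le]
    ring_nf
  have ht_le : t ≤ 2 / α * exp (α * (t / 2)) := by
    have := add_one_le_exp (α * (t / 2))
    rw [div_mul_eq_mul_div, le_div_iff₀ hα]
    linarith
  calc ∫ u in (0 : ℝ)..t, exp (α * u) * u ^ p
      ≤ ∫ u in (0 : ℝ)..t, (exp (α * u) * (t / 2) ^ p + exp (α * (t / 2)) * u ^ p) :=
        intervalIntegral.integral_mono_on_of_le_Ioo ht.le
          (hrpow.continuousOn_mul hexp.continuousOn) (hleft.add hright)
          fun u hu => exp_mul_rpow_le_add hα.le hp' ht hu.1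
    _ = (exp (α * t) - 1) / α * ((1 / 2) ^ p * t ^ p)
          + exp (α * (t / 2)) * (t ^ p * t / (p + 1)) := by
        rw [intervalIntegral.integral_add hleft hright, intervalIntegral.integral_mul_const,
          intervalIntegral.integral_const_mul, hint_exp, hint_rpow, hhalf]
    _ ≤ exp (α * t) / α * ((1 / 2) ^ p * t ^ p)
          + exp (α * (t / 2)) * (t ^ p * (2 / α * exp (α * (t / 2))) / (p + 1)) := by
        gcongr
        linarith
    _ = ((1 / 2) ^ p / α + 2 / (α * (p + 1))) * t ^ p * exp (α * t) := by
        rw [hsplit]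
        field_simp

theorem exp_rpow_integral_bound (α H : ℝ) (hα : 0 < α) (hH : H ∈ Set.Ioo (1/2 : ℝ) 1) :
    ∃ C : ℝ, 0 < C ∧ ∀ t : ℝ, 0 < t →
      ∫ u in Set.Ioc (0 : ℝ) t, Real.exp (α * u) * u ^ (2 * H - 2)
        ≤ C * t ^ (2 * H - 2) * Real.exp (α * t) := by
  obtain ⟨hH₁, hH₂⟩ := hH
  have hp : 0 < 2 * H - 2 + 1 := by linarith
  refine ⟨(1 / 2) ^ (2 * H - 2) / α + 2 / (α * (2 * H - 2 + 1)), by positivity, fun t ht => ?_⟩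
  rw [← intervalIntegral.integral_of_le ht.le]
  exact integral_exp_mul_rpow_le hα (by linarith) (by linarith) ht
end

section
/- Let n ≥ 1 be an integer and u > 0 a real number, and let f be either the function f(x) = √2·sin(2πnx) or the function f(x) = √2·cos(2πnx). Then ∫₀¹ ∫₀¹ f(t) f(s) (e^{u(1−|t−s|)} + e^{u|t−s|} − 2) dt ds = 2(e^u − 1)u / ((2πn)² + u²). In particular this quantity is strictly positive. -/
open Real

/-- A periodic solution `f` of the harmonic oscillator with frequency `w` is an
eigenfunction of convolution with `d ↦ exp (u (1 - d)) + exp (u d) - 2` on the unit circle. -/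
theorem integral_mul_exp_kernel_of_harmonic {f g : ℝ → ℝ} {w u t : ℝ} (hw : w ≠ 0)
    (hf : ∀ x, HasDerivAt f (g x) x) (hg : ∀ x, HasDerivAt g (-w ^ 2 * f x) x)
    (hf1 : f 1 = f 0) (hg1 : g 1 = g 0) (ht : t ∈ Set.Icc (0 : ℝ) 1) :
    (∫ s in (0 : ℝ)..1, f s * (exp (u * (1 - |t - s|)) + exp (u * |t - s|) - 2))
      = 2 * (exp u - 1) * u / (w ^ 2 + u ^ 2) * f t := by
  have hD : w ^ 2 + u ^ 2 ≠ 0 := by positivity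
  have hfc : Continuous f := continuous_iff_continuousAt.2 fun x => (hf x).continuousAt
  have antideriv (a b c x : ℝ) :
      HasDerivAt (fun s => (exp (a + u * s) * (u * f s - g s)
          + exp (b - u * s) * (-u * f s - g s)) / (w ^ 2 + u ^ 2) + c * (g s / w ^ 2))
        (f x * (exp (a + u * x) + exp (b - u * x) - c)) x := by
    have h1 : HasDerivAt (fun s => exp (a + u * s)) (exp (a + u * x) * (u * 1)) x :=
      (((hasDerivAt_id x).const_mul u).const_add a).exp
    have h2 : HasDerivAt (fun s => exp (b - u * s)) (exp (b - u * x) * (-(u * 1))) x :=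
      (((hasDerivAt_id x).const_mul u).const_sub b).exp
    have h := (((h1.mul (((hf x).const_mul u).sub (hg x))).add
      (h2.mul (((hf x).const_mul (-u)).sub (hg x)))).div_const (w ^ 2 + u ^ 2)).add
      (((hg x).div_const (w ^ 2)).const_mul c)
    refine h.congr_deriv ?_
    simp only [Pi.sub_apply]
    field_simp
    ring
  have integral_eq (a b c x y : ℝ) := intervalIntegral.integral_eq_sub_of_hasDerivAt
    (a := x) (b := y) (fun z _ => antideriv a b c z)
    (Continuous.intervalIntegrable (by fun_prop) _ _)
  have hc : Continuous fun s => f s * (exp (u * (1 - |t - s|)) + exp (u * |t - s|) - 2) := by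
    fun_prop
  have left : (∫ s in (0 : ℝ)..t, f s * (exp (u * (1 - |t - s|)) + exp (u * |t - s|) - 2))
      = ∫ s in (0 : ℝ)..t, f s * (exp (u * (1 - t) + u * s) + exp (u * t - u * s) - 2) := by
    refine intervalIntegral.integral_congr fun s hs => ?_
    rw [Set.uIcc_of_le ht.1] at hs
    simp only [abs_of_nonneg (sub_nonneg.2 hs.2)]
    ring_nf
  have right : (∫ s in t..1, f s * (exp (u * (1 - |t - s|)) + exp (u * |t - s|) - 2))
      = ∫ s in t..1, f s * (exp (-(u * t) + u * s) + exp (u * (1 + t) - u * s) - 2) := by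
    refine intervalIntegral.integral_congr fun s hs => ?_
    rw [Set.uIcc_of_le ht.2] at hs
    simp only [abs_of_nonpos (sub_nonpos.2 hs.1)]
    ring_nf
  rw [← intervalIntegral.integral_add_adjacent_intervals (hc.intervalIntegrable 0 t)
    (hc.intervalIntegrable t 1), left, right, integral_eq, integral_eq, hf1, hg1,
    show u * (1 - t) + u * t = u by ring, show u * t - u * t = 0 by ring,
    show u * (1 - t) + u * 0 = u * (1 - t) by ring, show u * t - u * 0 = u * t by ring,
    show -(u * t) + u * 1 = u * (1 - t) by ring, show u * (1 + t) - u * 1 = u * t by ring,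
    show -(u * t) + u * t = 0 by ring, show u * (1 + t) - u * t = u by ring, exp_zero]
  ring

/-- A periodic solution `f` of the harmonic oscillator with energy `g² + w² f² = 2 w²`
has unit `L²` norm. -/
theorem integral_sq_of_harmonic {f g : ℝ → ℝ} {w : ℝ} (hw : w ≠ 0)
    (hf : ∀ x, HasDerivAt f (g x) x) (hg : ∀ x, HasDerivAt g (-w ^ 2 * f x) x)
    (hf1 : f 1 = f 0) (hg1 : g 1 = g 0) (energy : ∀ x, g x ^ 2 + w ^ 2 * f x ^ 2 = 2 * w ^ 2) :
    ∫ t in (0 : ℝ)..1, f t ^ 2 = 1 := by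
  have hfc : Continuous f := continuous_iff_continuousAt.2 fun x => (hf x).continuousAt
  have antideriv (x : ℝ) :
      HasDerivAt (fun s => s - f s * g s / (2 * w ^ 2)) (f x ^ 2) x := by
    refine ((hasDerivAt_id x).sub (((hf x).mul (hg x)).div_const (2 * w ^ 2))).congr_deriv ?_
    field_simp
    linear_combination -energy x
  rw [intervalIntegral.integral_eq_sub_of_hasDerivAt (fun x _ => antideriv x)
    (Continuous.intervalIntegrable (by fun_prop) _ _), hf1, hg1]
  ring

theorem integral_integral_exp_kernel_of_harmonic {f g : ℝ → ℝ} {w u : ℝ} (hw : w ≠ 0)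
    (hf : ∀ x, HasDerivAt f (g x) x) (hg : ∀ x, HasDerivAt g (-w ^ 2 * f x) x)
    (hf1 : f 1 = f 0) (hg1 : g 1 = g 0) (energy : ∀ x, g x ^ 2 + w ^ 2 * f x ^ 2 = 2 * w ^ 2) :
    (∫ t in (0 : ℝ)..1, ∫ s in (0 : ℝ)..1,
        f t * f s * (exp (u * (1 - |t - s|)) + exp (u * |t - s|) - 2))
      = 2 * (exp u - 1) * u / (w ^ 2 + u ^ 2) := by
  have inner : Set.EqOn (fun t => ∫ s in (0 : ℝ)..1,
        f t * f s * (exp (u * (1 - |t - s|)) + exp (u * |t - s|) - 2))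
      (fun t => 2 * (exp u - 1) * u / (w ^ 2 + u ^ 2) * f t ^ 2) (Set.uIcc 0 1) := by
    intro t ht
    rw [Set.uIcc_of_le zero_le_one] at ht
    simp only [mul_assoc (f t), intervalIntegral.integral_const_mul]
    rw [integral_mul_exp_kernel_of_harmonic hw hf hg hf1 hg1 ht]
    ring
  rw [intervalIntegral.integral_congr inner, intervalIntegral.integral_const_mul,
    integral_sq_of_harmonic hw hf hg hf1 hg1 energy, mul_one]

theorem fourier_diag_double_integral (n : ℕ) (hn : 1 ≤ n) (u : ℝ) (hu : 0 < u)
    (f : ℝ → ℝ)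
    (hf : (∀ x, f x = Real.sqrt 2 * Real.sin (2 * π * n * x)) ∨
          (∀ x, f x = Real.sqrt 2 * Real.cos (2 * π * n * x))) :
    (∫ t in (0:ℝ)..1, ∫ s in (0:ℝ)..1,
        f t * f s * (Real.exp (u * (1 - |t - s|)) + Real.exp (u * |t - s|) - 2))
      = 2 * (Real.exp u - 1) * u / ((2 * π * n) ^ 2 + u ^ 2) ∧
    0 < 2 * (Real.exp u - 1) * u / ((2 * π * n) ^ 2 + u ^ 2) := by
  have hw : 2 * π * n ≠ 0 := by
    have : (n : ℝ) ≠ 0 := by exact_mod_cast (by omega : n ≠ 0)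
    positivity
  have hsin : sin (2 * π * n) = 0 := by
    simpa [mul_comm, mul_left_comm] using sin_nat_mul_pi (2 * n)
  have hcos : cos (2 * π * n) = 1 := by
    rw [mul_comm]
    exact cos_nat_mul_two_pi n
  have h2 : √2 ^ 2 = (2 : ℝ) := sq_sqrt zero_le_two
  refine ⟨?_, ?_⟩
  · generalize 2 * π * n = w at hf hw hsin hcos ⊢
    have dlin (x : ℝ) : HasDerivAt (fun y => w * y) (w * 1) x := (hasDerivAt_id x).const_mul w
    rcases hf with hf | hf <;> obtain rfl := funext hf
    · refine integral_integral_exp_kernel_of_harmonic (g := fun x => √2 * w * cos (w * x)) hw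
        (fun x => ((dlin x).sin.const_mul _).congr_deriv (by ring))
        (fun x => ((dlin x).cos.const_mul _).congr_deriv (by ring))
        (by simp [hsin]) (by simp [hcos]) fun x => ?_
      linear_combination √2 ^ 2 * w ^ 2 * sin_sq_add_cos_sq (w * x) + w ^ 2 * h2
    · refine integral_integral_exp_kernel_of_harmonic (g := fun x => -(√2 * w) * sin (w * x)) hw
        (fun x => ((dlin x).cos.const_mul _).congr_deriv (by ring))
        (fun x => ((dlin x).sin.const_mul _).congr_deriv (by ring))
        (by simp [hcos]) (by simp [hsin]) fun x => ?_
      linear_combination √2 ^ 2 * w ^ 2 * sin_sq_add_cos_sq (w * x) + w ^ 2 * h2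
  · have : 0 < exp u - 1 := sub_pos.2 (one_lt_exp_iff.2 hu)
    positivity
end

section
/- For n ∈ ℤ \ {0}, let f_n : ℝ → ℝ be defined by f_n(x) = √2·sin(2πnx) for n > 0 and f_n(x) = √2·cos(2π|n|x) for n < 0. Then for all m, n ∈ ℤ \ {0} with m ≠ n and all u > 0, ∫₀¹ ∫₀¹ f_n(t) f_m(s) (e^{u(1−|t−s|)} + e^{u|t−s|} − 2) dt ds = 0. -/
open Real

/-- The real Fourier basis function on `[0,1]` indexed by a nonzero integer:
`f_n(x) = √2 sin(2πnx)` for `n > 0` and `f_n(x) = √2 cos(2π|n|x)` for `n < 0`. -/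
noncomputable def fourierBasisFun (n : ℤ) (x : ℝ) : ℝ :=
  if 0 < n then Real.sqrt 2 * Real.sin (2 * π * n * x)
  else Real.sqrt 2 * Real.cos (2 * π * |(n : ℝ)| * x)

theorem fourierBasisFun_of_pos {n : ℤ} (hn : 0 < n) (x : ℝ) :
    fourierBasisFun n x = √2 * sin (2 * π * n * x) :=
  if_pos hn

theorem fourierBasisFun_eq_cos_of_not_pos {n : ℤ} (hn : ¬ 0 < n) (x : ℝ) :
    fourierBasisFun n x = √2 * cos (2 * π * n * x) := by
  have h : |(n : ℝ)| = -n := abs_of_nonpos (by exact_mod_cast not_lt.mp hn)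
  rw [fourierBasisFun, if_neg hn, h, ← cos_neg]
  congr 2
  ring

theorem continuous_fourierBasisFun (n : ℤ) : Continuous (fourierBasisFun n) := by
  unfold fourierBasisFun
  split_ifs <;> fun_prop

theorem fourierBasisFun_add_one (n : ℤ) (x : ℝ) :
    fourierBasisFun n (x + 1) = fourierBasisFun n x := by
  have h : 2 * π * n * (x + 1) = 2 * π * n * x + n * (2 * π) := by ring
  by_cases hn : 0 < n
  · rw [fourierBasisFun_of_pos hn, fourierBasisFun_of_pos hn, h, sin_add_int_mul_two_pi]
  · rw [fourierBasisFun_eq_cos_of_not_pos hn, fourierBasisFun_eq_cos_of_not_pos hn, h,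
      cos_add_int_mul_two_pi]

theorem fourierBasisFun_sub_add_fourierBasisFun_add (n : ℤ) (t r : ℝ) :
    fourierBasisFun n (t - r) + fourierBasisFun n (t + r) =
      2 * fourierBasisFun n t * cos (2 * π * n * r) := by
  by_cases hn : 0 < n
  · simp only [fourierBasisFun_of_pos hn, mul_sub, mul_add, sin_sub, sin_add]
    ring
  · simp only [fourierBasisFun_eq_cos_of_not_pos hn, mul_sub (2 * π * n), mul_add (2 * π * n),
      cos_sub, cos_add]
    ring

theorem integral_sin_two_pi_int_mul (k : ℤ) : ∫ x in (0 : ℝ)..1, sin (2 * π * k * x) = 0 := by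
  rcases eq_or_ne k 0 with rfl | hk
  · simp
  · have hc : 2 * π * (k : ℝ) ≠ 0 := by positivity
    have h : cos (2 * π * k) = 1 := by
      rw [mul_comm]
      exact cos_int_mul_two_pi k
    rw [intervalIntegral.integral_comp_mul_left (fun x => sin x) hc, integral_sin]
    simp [h]

theorem integral_cos_two_pi_int_mul {k : ℤ} (hk : k ≠ 0) :
    ∫ x in (0 : ℝ)..1, cos (2 * π * k * x) = 0 := by
  have hc : 2 * π * (k : ℝ) ≠ 0 := by positivity
  have h : sin (2 * π * k) = 0 := by
    have := sin_int_mul_pi (2 * k)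
    push_cast at this
    rwa [mul_right_comm] at this
  rw [intervalIntegral.integral_comp_mul_left (fun x => cos x) hc, integral_cos]
  simp [h]

theorem integral_fourierBasisFun_mul_of_ne {m n : ℤ} (hm : m ≠ 0) (hn : n ≠ 0) (hmn : m ≠ n) :
    ∫ t in (0 : ℝ)..1, fourierBasisFun n t * fourierBasisFun m t = 0 := by
  have h2 : √2 * √2 = 2 := mul_self_sqrt (by norm_num)
  have hS (k : ℤ) : IntervalIntegrable (fun x : ℝ => sin (2 * π * k * x))
      MeasureTheory.volume 0 1 :=
    Continuous.intervalIntegrable (by fun_prop) _ _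
  have hC (k : ℤ) : IntervalIntegrable (fun x : ℝ => cos (2 * π * k * x))
      MeasureTheory.volume 0 1 :=
    Continuous.intervalIntegrable (by fun_prop) _ _
  have hsub : n - m ≠ 0 := sub_ne_zero.mpr hmn.symm
  have e1 (t : ℝ) : 2 * π * ((n - m : ℤ) : ℝ) * t = 2 * π * n * t - 2 * π * m * t := by
    push_cast
    ring
  have e2 (t : ℝ) : 2 * π * ((n + m : ℤ) : ℝ) * t = 2 * π * n * t + 2 * π * m * t := by
    push_cast
    ring
  by_cases pn : 0 < n <;> by_cases pm : 0 < m
  · have h (t : ℝ) : fourierBasisFun n t * fourierBasisFun m t =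
        cos (2 * π * (n - m : ℤ) * t) - cos (2 * π * (n + m : ℤ) * t) := by
      rw [fourierBasisFun_of_pos pn, fourierBasisFun_of_pos pm, e1, e2, cos_sub, cos_add]
      linear_combination sin (2 * π * n * t) * sin (2 * π * m * t) * h2
    simp_rw [h]
    rw [intervalIntegral.integral_sub (hC _) (hC _), integral_cos_two_pi_int_mul hsub,
      integral_cos_two_pi_int_mul (by lia), sub_zero]
  · have h (t : ℝ) : fourierBasisFun n t * fourierBasisFun m t =
        sin (2 * π * (n + m : ℤ) * t) + sin (2 * π * (n - m : ℤ) * t) := by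
      rw [fourierBasisFun_of_pos pn, fourierBasisFun_eq_cos_of_not_pos pm, e1, e2, sin_sub,
        sin_add]
      linear_combination sin (2 * π * n * t) * cos (2 * π * m * t) * h2
    simp_rw [h]
    rw [intervalIntegral.integral_add (hS _) (hS _), integral_sin_two_pi_int_mul,
      integral_sin_two_pi_int_mul, add_zero]
  · have h (t : ℝ) : fourierBasisFun n t * fourierBasisFun m t =
        sin (2 * π * (n + m : ℤ) * t) - sin (2 * π * (n - m : ℤ) * t) := by
      rw [fourierBasisFun_of_pos pm, fourierBasisFun_eq_cos_of_not_pos pn, e1, e2, sin_sub,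
        sin_add]
      linear_combination cos (2 * π * n * t) * sin (2 * π * m * t) * h2
    simp_rw [h]
    rw [intervalIntegral.integral_sub (hS _) (hS _), integral_sin_two_pi_int_mul,
      integral_sin_two_pi_int_mul, sub_zero]
  · have h (t : ℝ) : fourierBasisFun n t * fourierBasisFun m t =
        cos (2 * π * (n - m : ℤ) * t) + cos (2 * π * (n + m : ℤ) * t) := by
      rw [fourierBasisFun_eq_cos_of_not_pos pn, fourierBasisFun_eq_cos_of_not_pos pm, e1, e2,
        cos_sub, cos_add]
      linear_combination cos (2 * π * n * t) * cos (2 * π * m * t) * h2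
    simp_rw [h]
    rw [intervalIntegral.integral_add (hC _) (hC _), integral_cos_two_pi_int_mul hsub,
      integral_cos_two_pi_int_mul (by lia), add_zero]

/-- A kernel `g |t - s|` with `g (1 - x) = g x` acts on `1`-periodic functions as a circular
convolution. -/
theorem integral_mul_abs_sub_eq_integral_comp_sub_mul {f g : ℝ → ℝ} (hf : Continuous f)
    (hg : Continuous g) (hper : ∀ x, f (x + 1) = f x) (hsymm : ∀ x, g (1 - x) = g x)
    {t : ℝ} (ht : t ∈ Set.Icc (0 : ℝ) 1) :
    ∫ s in (0 : ℝ)..1, f s * g |t - s| = ∫ r in (0 : ℝ)..1, f (t - r) * g r := by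
  have hleft : ∫ s in (0 : ℝ)..t, f s * g |t - s| = ∫ r in (0 : ℝ)..t, f (t - r) * g r := by
    have h := intervalIntegral.integral_comp_sub_left (a := 0) (b := t)
      (fun s => f s * g |t - s|) t
    rw [sub_self, sub_zero] at h
    rw [← h]
    refine intervalIntegral.integral_congr fun r hr => ?_
    rw [Set.uIcc_of_le ht.1] at hr
    simp only [sub_sub_cancel, abs_of_nonneg hr.1]
  have hright : ∫ s in t..1, f s * g |t - s| = ∫ r in t..1, f (t - r) * g r := by
    have h := intervalIntegral.integral_comp_sub_left (a := t) (b := 1)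
      (fun s => f s * g |t - s|) (t + 1)
    rw [add_sub_cancel_right, add_sub_cancel_left] at h
    rw [← h]
    refine intervalIntegral.integral_congr fun r hr => ?_
    rw [Set.uIcc_of_le ht.2] at hr
    have habs : |t - (t + 1 - r)| = 1 - r := by
      rw [abs_of_nonpos (by linarith [hr.2])]
      ring
    simp only [habs, hsymm]
    rw [add_sub_right_comm, hper]
  have hcont : Continuous fun s => f s * g |t - s| := by fun_prop
  have hcont' : Continuous fun r => f (t - r) * g r := by fun_prop
  rw [← intervalIntegral.integral_add_adjacent_intervals (hcont.intervalIntegrable 0 t)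
      (hcont.intervalIntegrable t 1), hleft, hright,
    intervalIntegral.integral_add_adjacent_intervals (hcont'.intervalIntegrable 0 t)
      (hcont'.intervalIntegrable t 1)]

/-- The functions `fourierBasisFun m` are eigenfunctions of every kernel `g |t - s|` with
`g (1 - x) = g x`. -/
theorem integral_fourierBasisFun_mul_abs_sub (m : ℤ) {g : ℝ → ℝ} (hg : Continuous g)
    (hsymm : ∀ x, g (1 - x) = g x) {t : ℝ} (ht : t ∈ Set.Icc (0 : ℝ) 1) :
    ∫ s in (0 : ℝ)..1, fourierBasisFun m s * g |t - s| =
      fourierBasisFun m t * ∫ r in (0 : ℝ)..1, cos (2 * π * m * r) * g r := by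
  have hf := continuous_fourierBasisFun m
  rw [integral_mul_abs_sub_eq_integral_comp_sub_mul hf hg (fourierBasisFun_add_one m) hsymm ht]
  have hrefl : ∫ r in (0 : ℝ)..1, fourierBasisFun m (t + r) * g r =
      ∫ r in (0 : ℝ)..1, fourierBasisFun m (t - r) * g r := by
    have h := intervalIntegral.integral_comp_sub_left (a := 0) (b := 1)
      (fun r => fourierBasisFun m (t + r) * g r) 1
    rw [sub_self, sub_zero] at h
    rw [← h]
    refine intervalIntegral.integral_congr fun r _ => ?_
    have e : t + (1 - r) = t - r + 1 := by ring
    simp only [hsymm, e, fourierBasisFun_add_one]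
  have hcont : Continuous fun r => fourierBasisFun m (t - r) * g r := by fun_prop
  have hcont' : Continuous fun r => fourierBasisFun m (t + r) * g r := by fun_prop
  have hsum : (∫ r in (0 : ℝ)..1, fourierBasisFun m (t - r) * g r) +
      ∫ r in (0 : ℝ)..1, fourierBasisFun m (t + r) * g r =
      2 * fourierBasisFun m t * ∫ r in (0 : ℝ)..1, cos (2 * π * m * r) * g r := by
    rw [← intervalIntegral.integral_add (hcont.intervalIntegrable 0 1)
      (hcont'.intervalIntegrable 0 1), ← intervalIntegral.integral_const_mul]
    refine intervalIntegral.integral_congr fun r _ => ?_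
    rw [← add_mul, fourierBasisFun_sub_add_fourierBasisFun_add, mul_assoc]
  linarith

theorem fourier_offdiag_double_integral (m n : ℤ) (hm : m ≠ 0) (hn : n ≠ 0)
    (hmn : m ≠ n) (u : ℝ) (hu : 0 < u) :
    (∫ t in (0:ℝ)..1, ∫ s in (0:ℝ)..1,
        fourierBasisFun n t * fourierBasisFun m s *
          (Real.exp (u * (1 - |t - s|)) + Real.exp (u * |t - s|) - 2)) = 0 := by
  set g : ℝ → ℝ := fun x => exp (u * (1 - x)) + exp (u * x) - 2 with hg
  have hcont : Continuous g := by fun_prop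
  have hsymm (x : ℝ) : g (1 - x) = g x := by
    simp only [hg, sub_sub_cancel]
    ring
  have hinner : ∀ t ∈ Set.uIcc (0 : ℝ) 1,
      (∫ s in (0 : ℝ)..1, fourierBasisFun n t * fourierBasisFun m s * g |t - s|) =
        fourierBasisFun n t * fourierBasisFun m t *
          ∫ r in (0 : ℝ)..1, cos (2 * π * m * r) * g r := by
    intro t ht
    rw [Set.uIcc_of_le zero_le_one] at ht
    simp_rw [mul_assoc (fourierBasisFun n t)]
    rw [intervalIntegral.integral_const_mul,
      integral_fourierBasisFun_mul_abs_sub m hcont hsymm ht]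
  calc (∫ t in (0 : ℝ)..1, ∫ s in (0 : ℝ)..1,
        fourierBasisFun n t * fourierBasisFun m s * g |t - s|)
      = ∫ t in (0 : ℝ)..1, fourierBasisFun n t * fourierBasisFun m t *
          ∫ r in (0 : ℝ)..1, cos (2 * π * m * r) * g r :=
        intervalIntegral.integral_congr hinner
    _ = 0 := by
        rw [intervalIntegral.integral_mul_const, integral_fourierBasisFun_mul_of_ne hm hn hmn,
          zero_mul]
end

section
/- Let H ∈ (1/2, 1) and let φ : ℝ → ℝ be a bounded measurable 1-periodic function with ∫₀¹ φ(t) dt = 0. Then, as n → ∞ over the positive integers, (1/n) ∫₀ⁿ ∫₀ⁿ φ(t) φ(s) |t−s|^{2H−2} dt ds converges to ∫₀¹ ∫₀¹ φ(t) φ(s) |t−s|^{2H−2} dt ds + Σ_{l=1}^∞ 2·C(2H−2, 2l)·ζ(2l+2−2H)·∫₀¹ ∫₀¹ φ(t) φ(s) (t−s)^{2l} dt ds, where C(2H−2, 2l) denotes the generalized binomial coefficient (2H−2)(2H−3)⋯(2H−2−(2l−1)) / (2l)!, and ζ is the Riemann zeta function. -/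
open Real MeasureTheory Filter

/-- Generalized binomial coefficient `C(a, k) = a(a-1)⋯(a-k+1)/k!` for real `a`. -/
noncomputable def genBinom (a : ℝ) (k : ℕ) : ℝ :=
  (∏ i ∈ Finset.range k, (a - i)) / (Nat.factorial k : ℝ)

/-- The Riemann zeta function for real argument, `ζ(s) = ∑_{m=1}^∞ m^{-s}`. -/
noncomputable def zetaReal (s : ℝ) : ℝ := ∑' m : ℕ, ((m : ℝ) + 1) ^ (-s)

theorem genBinom_eq_choose (a : ℝ) (k : ℕ) : genBinom a k = Ring.choose a k := by
  rw [Ring.choose_eq_smul, genBinom, smul_eq_mul, div_eq_inv_mul]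
  congr 1
  induction k with
  | zero => simp
  | succ k ih =>
    rw [Finset.prod_range_succ, ih, descPochhammer_succ_right, Polynomial.smeval_mul,
      Polynomial.smeval_sub]
    simp [Polynomial.smeval_natCast]

theorem abs_genBinom_le_one {a : ℝ} (ha : -1 < a) (ha0 : a < 0) (k : ℕ) : |genBinom a k| ≤ 1 := by
  rw [genBinom, abs_div, Nat.abs_cast, div_le_one (by positivity), Finset.abs_prod,
    ← Finset.prod_range_add_one_eq_factorial]
  push_cast
  refine Finset.prod_le_prod (fun _ _ => abs_nonneg _) fun i _ => ?_
  have : (0 : ℝ) ≤ i := i.cast_nonneg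
  rw [abs_le]; constructor <;> linarith

theorem hasSum_genBinom (a : ℝ) {x : ℝ} (hx : |x| < 1) :
    HasSum (fun k => genBinom a k * x ^ k) ((1 + x) ^ a) := by
  have h := (Real.one_add_rpow_hasFPowerSeriesOnBall_zero (a := a)).hasSum (y := x)
    (by simpa [Metric.mem_eball, edist_dist, ENNReal.ofReal_lt_one] using hx)
  simpa [binomialSeries, genBinom_eq_choose, FormalMultilinearSeries.ofScalars_apply_eq, mul_comm] using h

theorem hasSum_genBinom_even (a : ℝ) {x : ℝ} (hx : |x| < 1) :
    HasSum (fun l : ℕ => 2 * genBinom a (2 * (l + 1)) * x ^ (2 * (l + 1)))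
      ((1 + x) ^ a + (1 - x) ^ a - 2) := by
  have h := (hasSum_genBinom a hx).add (hasSum_genBinom a (x := -x) (by simpa using hx))
  rw [← (mul_right_injective₀ (two_ne_zero (α := ℕ))).hasSum_iff, ← hasSum_nat_add_iff' 1] at h
  · have e : (fun l : ℕ => 2 * genBinom a (2 * (l + 1)) * x ^ (2 * (l + 1))) =
        fun l => ((fun k => genBinom a k * x ^ k + genBinom a k * (-x) ^ k) ∘ fun l => 2 * l)
          (l + 1) := by
      ext l
      simp only [Function.comp, Even.neg_pow (even_two_mul _)]
      ring
    rw [e]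
    simpa [genBinom, ← sub_eq_add_neg, one_add_one_eq_two] using h
  · intro k hk
    have hodd : Odd k := by
      rw [← Nat.not_even_iff_odd, even_iff_exists_two_mul]
      rintro ⟨c, rfl⟩
      exact hk ⟨c, rfl⟩
    rw [hodd.neg_pow]; ring

theorem hasSum_abs_rpow_symm (a : ℝ) {x r : ℝ} (hr : 1 ≤ r) (hx : |x| < 1) :
    HasSum (fun l : ℕ => 2 * genBinom a (2 * (l + 1)) * r ^ (a - 2 * (l + 1)) * x ^ (2 * (l + 1)))
      (|x + r| ^ a + |x - r| ^ a - 2 * r ^ a) := by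
  have hr0 : 0 < r := by linarith
  obtain ⟨h1, h2⟩ := abs_lt.1 hx
  have hxr : |x / r| < 1 := by
    rw [abs_div, abs_of_pos hr0, div_lt_one hr0]; linarith
  obtain ⟨h3, h4⟩ := abs_lt.1 hxr
  have e1 : |x + r| ^ a + |x - r| ^ a - 2 * r ^ a =
      r ^ a * ((1 + x / r) ^ a + (1 - x / r) ^ a - 2) := by
    rw [abs_of_pos (by linarith : 0 < x + r), abs_sub_comm, abs_of_pos (by linarith : 0 < r - x),
      mul_sub, mul_add, ← mul_rpow hr0.le (by linarith), ← mul_rpow hr0.le (by linarith),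
      mul_add, mul_sub, mul_div_cancel₀ _ hr0.ne', mul_one, add_comm x r, mul_comm 2]
  have e2 : ∀ l : ℕ, 2 * genBinom a (2 * (l + 1)) * r ^ (a - 2 * (l + 1)) * x ^ (2 * (l + 1)) =
      r ^ a * (2 * genBinom a (2 * (l + 1)) * (x / r) ^ (2 * (l + 1))) := by
    intro l
    have h : r ^ (2 * ((l : ℝ) + 1)) = r ^ (2 * (l + 1)) := by
      rw [← rpow_natCast]; push_cast; rfl
    rw [rpow_sub hr0, div_pow, h]
    ring
  rw [e1]
  simp_rw [e2]
  exact (hasSum_genBinom_even a hxr).mul_left (r ^ a)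

theorem sum_sum_sub_eq (c : ℤ → ℝ) (n : ℕ) :
    ∑ i ∈ Finset.range n, ∑ j ∈ Finset.range n, c ((i : ℤ) - j) =
      ∑ i ∈ Finset.range n, (c 0 + ∑ m ∈ Finset.range i, (c (m + 1) + c (-(m + 1)))) := by
  induction n with
  | zero => simp
  | succ n ih =>
    simp_rw [Finset.sum_range_succ _ n, Finset.sum_add_distrib, sub_self]
    rw [Finset.sum_add_distrib] at ih
    have e1 : ∑ j ∈ Finset.range n, c ((n : ℤ) - j) = ∑ m ∈ Finset.range n, c (m + 1) := by
      rw [← Finset.sum_range_reflect]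
      refine Finset.sum_congr rfl fun j hj => ?_
      have := Finset.mem_range.1 hj
      congr 1; omega
    have e2 : ∑ j ∈ Finset.range n, c ((j : ℤ) - n) = ∑ m ∈ Finset.range n, c (-(m + 1)) := by
      rw [← Finset.sum_range_reflect]
      refine Finset.sum_congr rfl fun j hj => ?_
      have := Finset.mem_range.1 hj
      congr 1; omega
    simp_rw [Finset.sum_add_distrib] at ih ⊢
    rw [e1, e2, ih]; ring

theorem intervalIntegrable_abs_rpow {a : ℝ} (ha : -1 < a) (b c : ℝ) :
    IntervalIntegrable (fun x : ℝ => |x| ^ a) volume b c := by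
  have key : ∀ d : ℝ, 0 ≤ d → IntervalIntegrable (fun x : ℝ => |x| ^ a) volume 0 d := by
    intro d hd
    refine (intervalIntegral.intervalIntegrable_rpow' (a := 0) (b := d) ha).congr ?_
    intro x hx
    rw [Set.uIoc_of_le hd] at hx
    simp [abs_of_pos hx.1]
  have key2 : ∀ d : ℝ, IntervalIntegrable (fun x : ℝ => |x| ^ a) volume 0 d := by
    intro d
    rcases le_total 0 d with hd | hd
    · exact key d hd
    · rw [IntervalIntegrable.iff_comp_neg]
      simpa using key (-d) (by linarith)
  exact (key2 b).symm.trans (key2 c)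

/-- Lebesgue measure on the unit interval. -/
noncomputable abbrev unitMeasure : Measure ℝ := volume.restrict (Set.Ioc 0 1)

theorem integrable_abs_sub_rpow {a : ℝ} (ha : -1 < a) (k : ℝ) :
    Integrable (fun p : ℝ × ℝ => |p.1 - p.2 + k| ^ a) (unitMeasure.prod unitMeasure) := by
  have hf : Integrable (fun _ : ℝ => (1 : ℝ)) unitMeasure := integrable_const _
  have hg : Integrable ((Set.Ioc (-1 : ℝ) 1).indicator fun x => |x + k| ^ a) volume := by
    rw [integrable_indicator_iff measurableSet_Ioc]
    have h := (intervalIntegrable_abs_rpow ha (-1 + k) (1 + k)).comp_add_right k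
    rw [add_sub_cancel_right, add_sub_cancel_right,
      intervalIntegrable_iff_integrableOn_Ioc_of_le (by norm_num)] at h
    exact h
  have h := (hf.convolution_integrand (ContinuousLinearMap.mul ℝ ℝ) hg).restrict
    (s := Set.Ioc 0 1 ×ˢ Set.Ioc 0 1)
  have e : (volume.prod unitMeasure).restrict (Set.Ioc (0:ℝ) 1 ×ˢ Set.Ioc (0:ℝ) 1) =
      unitMeasure.prod unitMeasure := by
    rw [← Measure.prod_restrict, Measure.restrict_restrict measurableSet_Ioc, Set.inter_self]
  rw [e] at h
  refine h.congr ?_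
  rw [Measure.prod_restrict]
  filter_upwards [ae_restrict_mem (measurableSet_Ioc.prod measurableSet_Ioc)] with p hp
  obtain ⟨⟨h1, h2⟩, h3, h4⟩ := hp
  rw [Set.indicator_of_mem (by constructor <;> linarith)]
  simp

/-- The correlation of `φ` with itself on the unit square against the kernel `|t - s + k| ^ a`. -/
noncomputable def shiftedCovariance (φ : ℝ → ℝ) (a k : ℝ) : ℝ :=
  ∫ t in (0 : ℝ)..1, ∫ s in (0 : ℝ)..1, φ t * φ s * |t - s + k| ^ a

theorem intervalIntegral_intervalIntegral_eq_prod {f : ℝ × ℝ → ℝ}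
    (hf : Integrable f (unitMeasure.prod unitMeasure)) :
    ∫ t in (0 : ℝ)..1, ∫ s in (0 : ℝ)..1, f (t, s) = ∫ p, f p ∂(unitMeasure.prod unitMeasure) := by
  rw [integral_prod _ hf]
  simp_rw [intervalIntegral.integral_of_le zero_le_one]

theorem ae_abs_sub_lt_one :
    ∀ᵐ p : ℝ × ℝ ∂(unitMeasure.prod unitMeasure), |p.1 - p.2| < 1 := by
  rw [Measure.prod_restrict]
  filter_upwards [ae_restrict_mem (measurableSet_Ioc.prod measurableSet_Ioc)] with p hp
  obtain ⟨⟨h1, h2⟩, h3, h4⟩ := hp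
  rw [abs_lt]; constructor <;> linarith

theorem abs_mul_le_sq {φ : ℝ → ℝ} {M : ℝ} (hbdd : ∀ x, |φ x| ≤ M) (t s : ℝ) :
    |φ t * φ s| ≤ M ^ 2 := by
  rw [abs_mul, sq]
  exact mul_le_mul (hbdd t) (hbdd s) (abs_nonneg _) ((abs_nonneg _).trans (hbdd t))

theorem integrable_mul_mul_abs_rpow {φ : ℝ → ℝ} (hmeas : Measurable φ) {M : ℝ}
    (hbdd : ∀ x, |φ x| ≤ M) {a : ℝ} (ha : -1 < a) (k : ℝ) :
    Integrable (fun p : ℝ × ℝ => φ p.1 * φ p.2 * |p.1 - p.2 + k| ^ a)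
      (unitMeasure.prod unitMeasure) :=
  (integrable_abs_sub_rpow ha k).bdd_mul (c := M ^ 2) (by fun_prop)
    (ae_of_all _ fun p => abs_mul_le_sq hbdd p.1 p.2)

theorem integrable_mul_mul_pow {φ : ℝ → ℝ} (hmeas : Measurable φ) {M : ℝ}
    (hbdd : ∀ x, |φ x| ≤ M) (k : ℕ) :
    Integrable (fun p : ℝ × ℝ => φ p.1 * φ p.2 * (p.1 - p.2) ^ k)
      (unitMeasure.prod unitMeasure) := by
  refine Integrable.of_bound (C := M ^ 2) (by fun_prop) ?_
  filter_upwards [ae_abs_sub_lt_one] with p hp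
  rw [norm_mul, norm_pow, Real.norm_eq_abs, Real.norm_eq_abs]
  have := mul_le_mul (abs_mul_le_sq hbdd p.1 p.2) (pow_le_one₀ (n := k) (abs_nonneg _) hp.le)
    (by positivity) (sq_nonneg M)
  simpa only [mul_one] using this

theorem integrable_sub_pow (k : ℕ) :
    Integrable (fun p : ℝ × ℝ => (p.1 - p.2) ^ k) (unitMeasure.prod unitMeasure) := by
  simpa using integrable_mul_mul_pow (φ := fun _ => 1) measurable_const (M := 1) (by simp) k

theorem integral_sub_pow_even (l : ℕ) :
    ∫ p : ℝ × ℝ, (p.1 - p.2) ^ (2 * (l + 1)) ∂(unitMeasure.prod unitMeasure) =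
      2 / ((2 * l + 3) * (2 * l + 4)) := by
  rw [← intervalIntegral_intervalIntegral_eq_prod (integrable_sub_pow _)]
  have h : ∀ t : ℝ, ∫ s in (0 : ℝ)..1, (t - s) ^ (2 * (l + 1)) =
      (t ^ (2 * l + 3) - (t - 1) ^ (2 * l + 3)) / (2 * l + 3) := by
    intro t
    rw [intervalIntegral.integral_comp_sub_left (fun x => x ^ (2 * (l + 1))), integral_pow]
    push_cast
    congr 1 <;> ring_nf
  simp_rw [h]
  rw [intervalIntegral.integral_div, intervalIntegral.integral_sub
    (Continuous.intervalIntegrable (by fun_prop) _ _)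
    (Continuous.intervalIntegrable (by fun_prop) _ _),
    intervalIntegral.integral_comp_sub_right (fun x => x ^ (2 * l + 3)), integral_pow, integral_pow]
  have h0 : ((0 : ℝ) - 1) ^ (2 * l + 3 + 1) = 1 := by
    rw [zero_sub, Even.neg_one_pow ⟨l + 2, by ring⟩]
  rw [h0]
  push_cast
  simp
  field_simp
  ring

theorem integral_abs_mul_mul_pow_le {φ : ℝ → ℝ} (hmeas : Measurable φ) {M : ℝ}
    (hbdd : ∀ x, |φ x| ≤ M) (l : ℕ) :
    ∫ p : ℝ × ℝ, |φ p.1 * φ p.2 * (p.1 - p.2) ^ (2 * (l + 1))| ∂(unitMeasure.prod unitMeasure) ≤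
      M ^ 2 * (1 / ((l : ℝ) + 1) ^ 2) := by
  calc _ ≤ ∫ p : ℝ × ℝ, M ^ 2 * (p.1 - p.2) ^ (2 * (l + 1)) ∂(unitMeasure.prod unitMeasure) := by
        refine integral_mono (integrable_mul_mul_pow hmeas hbdd _).abs
          ((integrable_sub_pow _).const_mul _) fun p => ?_
        have : 0 ≤ (p.1 - p.2) ^ (2 * (l + 1)) := (even_two_mul _).pow_nonneg _
        simp only
        rw [abs_mul, abs_of_nonneg this]
        exact mul_le_mul_of_nonneg_right (abs_mul_le_sq hbdd _ _) this
    _ ≤ _ := by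
        rw [integral_const_mul, integral_sub_pow_even]
        refine mul_le_mul_of_nonneg_left ?_ (sq_nonneg M)
        rw [div_le_div_iff₀ (by positivity) (by positivity)]
        have : (0 : ℝ) ≤ l := l.cast_nonneg
        nlinarith

theorem integral_mul_mul_eq_zero {φ : ℝ → ℝ} (hzero : (∫ t in (0 : ℝ)..1, φ t) = 0) :
    ∫ p : ℝ × ℝ, φ p.1 * φ p.2 ∂(unitMeasure.prod unitMeasure) = 0 := by
  rw [integral_prod_mul, ← intervalIntegral.integral_of_le zero_le_one, hzero, zero_mul]

theorem integral_integral_eq_sum_shiftedCovariance {φ : ℝ → ℝ} (hmeas : Measurable φ) {M : ℝ}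
    (hbdd : ∀ x, |φ x| ≤ M) (hper : ∀ x, φ (x + 1) = φ x) {a : ℝ} (ha : -1 < a) (n : ℕ) :
    ∫ t in (0 : ℝ)..n, ∫ s in (0 : ℝ)..n, φ t * φ s * |t - s| ^ a =
      ∑ i ∈ Finset.range n, ∑ j ∈ Finset.range n, shiftedCovariance φ a ((i : ℤ) - j : ℤ) := by
  have hperN : ∀ (x : ℝ) (i : ℕ), φ (x + i) = φ x := fun x i => by
    simpa using (show Function.Periodic φ 1 from hper).nat_mul i x
  have hslice : ∀ t b c : ℝ, IntervalIntegrable (fun s => φ t * φ s * |t - s| ^ a) volume b c := by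
    intro t b c
    have h := (intervalIntegrable_abs_rpow ha (t - b) (t - c)).comp_sub_left t
    rw [sub_sub_cancel, sub_sub_cancel, intervalIntegrable_iff] at h
    rw [intervalIntegrable_iff]
    exact h.bdd_mul (c := M ^ 2) (by fun_prop) (ae_of_all _ fun s => abs_mul_le_sq hbdd t s)
  have hinner : ∀ t : ℝ, ∫ s in (0 : ℝ)..n, φ t * φ s * |t - s| ^ a =
      ∑ j ∈ Finset.range n, ∫ s in (0 : ℝ)..1, φ t * φ s * |t - s - j| ^ a := by
    intro t
    have h := intervalIntegral.sum_integral_adjacent_intervals (a := fun k : ℕ => (k : ℝ)) (n := n)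
      fun k _ => hslice t k (k + 1 : ℕ)
    rw [Nat.cast_zero] at h
    rw [← h]
    refine Finset.sum_congr rfl fun j _ => ?_
    have h2 := intervalIntegral.integral_comp_add_right
      (fun s => φ t * φ s * |t - s| ^ a) (a := 0) (b := 1) (j : ℝ)
    rw [zero_add, add_comm 1] at h2
    push_cast
    rw [← h2]
    simp_rw [hperN, sub_add_eq_sub_sub]
  simp_rw [hinner]
  have hshift : ∀ (i j : ℕ) (t : ℝ),
      ∫ s in (0 : ℝ)..1, φ (t + i) * φ s * |t + i - s - j| ^ a =
        ∫ s in (0 : ℝ)..1, φ t * φ s * |t - s + ((i : ℤ) - j : ℤ)| ^ a := by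
    intro i j t
    rw [hperN]
    push_cast
    congr! 5
    ring_nf
  have hint : ∀ i j : ℕ, IntervalIntegrable
      (fun t => ∫ s in (0 : ℝ)..1, φ t * φ s * |t - s + ((i : ℤ) - j : ℤ)| ^ a) volume 0 1 := by
    intro i j
    rw [intervalIntegrable_iff_integrableOn_Ioc_of_le zero_le_one]
    have := (integrable_mul_mul_abs_rpow hmeas hbdd ha ((i : ℤ) - j : ℤ)).integral_prod_left
    simp_rw [intervalIntegral.integral_of_le zero_le_one]
    exact this
  have hint2 : ∀ i j : ℕ, IntervalIntegrable
      (fun t => ∫ s in (0 : ℝ)..1, φ t * φ s * |t - s - j| ^ a) volume i (i + 1 : ℕ) := by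
    intro i j
    have h := hint i j
    simp_rw [← hshift] at h
    have h3 := h.comp_sub_right (i : ℝ)
    simpa [add_comm] using h3
  have h := intervalIntegral.sum_integral_adjacent_intervals (a := fun k : ℕ => (k : ℝ)) (n := n)
    (f := fun t => ∑ j ∈ Finset.range n, ∫ s in (0 : ℝ)..1, φ t * φ s * |t - s - j| ^ a)
    (μ := volume) fun k _ => by
      rw [← Finset.sum_fn]
      exact IntervalIntegrable.sum _ fun j _ => hint2 k j
  rw [Nat.cast_zero] at h
  rw [← h]
  refine Finset.sum_congr rfl fun i _ => ?_
  rw [intervalIntegral.integral_finsetSum fun j _ => hint2 i j]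
  refine Finset.sum_congr rfl fun j _ => ?_
  have h2 := intervalIntegral.integral_comp_add_right
    (fun t => ∫ s in (0 : ℝ)..1, φ t * φ s * |t - s - j| ^ a) (a := 0) (b := 1) (i : ℝ)
  rw [zero_add, add_comm 1] at h2
  push_cast
  rw [← h2]
  simp_rw [hshift]
  simp [shiftedCovariance]

/-- The moment of order `2 * (l + 1)` of `t - s` against `φ t * φ s` on the unit square. -/
noncomputable def evenMoment (φ : ℝ → ℝ) (l : ℕ) : ℝ :=
  ∫ t in (0 : ℝ)..1, ∫ s in (0 : ℝ)..1, φ t * φ s * (t - s) ^ (2 * (l + 1))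

theorem abs_evenMoment_le {φ : ℝ → ℝ} (hmeas : Measurable φ) {M : ℝ}
    (hbdd : ∀ x, |φ x| ≤ M) (l : ℕ) : |evenMoment φ l| ≤ M ^ 2 * (1 / ((l : ℝ) + 1) ^ 2) := by
  rw [evenMoment, intervalIntegral_intervalIntegral_eq_prod (integrable_mul_mul_pow hmeas hbdd _)]
  exact abs_integral_le_integral_abs.trans (integral_abs_mul_mul_pow_le hmeas hbdd l)

theorem summable_one_div_nat_add_one_sq : Summable fun l : ℕ => 1 / ((l : ℝ) + 1) ^ 2 := by
  simpa using (summable_nat_add_iff 1).2 (Real.summable_one_div_nat_pow.2 one_lt_two)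

theorem abs_coeff_le {a : ℝ} (ha : -1 < a) (ha0 : a < 0) (m l : ℕ) :
    |2 * genBinom a (2 * (l + 1)) * ((m : ℝ) + 1) ^ (a - 2 * (l + 1))| ≤
      2 * (1 / ((m : ℝ) + 1) ^ 2) := by
  have h1 : ((m : ℝ) + 1) ^ (a - 2 * (l + 1)) ≤ 1 / ((m : ℝ) + 1) ^ 2 := by
    rw [one_div, ← rpow_natCast, ← rpow_neg (by positivity)]
    refine rpow_le_rpow_of_exponent_le (by simp) ?_
    have : (0 : ℝ) ≤ l := l.cast_nonneg
    push_cast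
    linarith
  have h2 : 0 ≤ ((m : ℝ) + 1) ^ (a - 2 * (l + 1)) := by positivity
  rw [abs_mul, abs_mul, abs_two, abs_of_nonneg h2, mul_assoc]
  refine mul_le_mul_of_nonneg_left ?_ zero_le_two
  exact (mul_le_of_le_one_left h2 (abs_genBinom_le_one ha ha0 _)).trans h1

theorem hasSum_shiftedCovariance_symm {φ : ℝ → ℝ} (hmeas : Measurable φ) {M : ℝ}
    (hbdd : ∀ x, |φ x| ≤ M) (hzero : (∫ t in (0 : ℝ)..1, φ t) = 0)
    {a : ℝ} (ha : -1 < a) (ha0 : a < 0) (m : ℕ) :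
    HasSum (fun l : ℕ => 2 * genBinom a (2 * (l + 1)) * ((m : ℝ) + 1) ^ (a - 2 * (l + 1)) *
      evenMoment φ l) (shiftedCovariance φ a (m + 1) + shiftedCovariance φ a (-(m + 1))) := by
  set P := unitMeasure.prod unitMeasure
  set A : ℕ → ℝ := fun l => 2 * genBinom a (2 * (l + 1)) * ((m : ℝ) + 1) ^ (a - 2 * (l + 1))
    with hA
  have hF : ∀ l, Integrable
      (fun p : ℝ × ℝ => A l * (φ p.1 * φ p.2 * (p.1 - p.2) ^ (2 * (l + 1)))) P :=
    fun l => (integrable_mul_mul_pow hmeas hbdd _).const_mul _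
  have hsum : Summable fun l => ∫ p : ℝ × ℝ,
      ‖A l * (φ p.1 * φ p.2 * (p.1 - p.2) ^ (2 * (l + 1)))‖ ∂P := by
    refine Summable.of_nonneg_of_le (fun l => integral_nonneg fun p => norm_nonneg _) (fun l => ?_)
      ((summable_one_div_nat_add_one_sq.mul_left (M ^ 2)).mul_left (2 * (1 / ((m : ℝ) + 1) ^ 2)))
    simp_rw [norm_mul (A l), integral_const_mul]
    exact mul_le_mul (abs_coeff_le ha ha0 m l) (integral_abs_mul_mul_pow_le hmeas hbdd l)
      (integral_nonneg fun p => norm_nonneg _) (by positivity)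
  have h := hasSum_integral_of_summable_integral_norm hF hsum
  have e1 : ∀ l, ∫ p : ℝ × ℝ, A l * (φ p.1 * φ p.2 * (p.1 - p.2) ^ (2 * (l + 1))) ∂P =
      A l * evenMoment φ l := fun l => by
    rw [integral_const_mul, evenMoment,
      intervalIntegral_intervalIntegral_eq_prod (integrable_mul_mul_pow hmeas hbdd _)]
  have i1 := integrable_mul_mul_abs_rpow hmeas hbdd ha ((m : ℝ) + 1)
  have i2 := integrable_mul_mul_abs_rpow hmeas hbdd ha (-((m : ℝ) + 1))
  have i3 : Integrable (fun p : ℝ × ℝ => φ p.1 * φ p.2) P := by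
    simpa using integrable_mul_mul_pow hmeas hbdd 0
  have e2 : ∫ p : ℝ × ℝ, ∑' l, A l * (φ p.1 * φ p.2 * (p.1 - p.2) ^ (2 * (l + 1))) ∂P =
      shiftedCovariance φ a (m + 1) + shiftedCovariance φ a (-(m + 1)) := by
    rw [shiftedCovariance, shiftedCovariance, intervalIntegral_intervalIntegral_eq_prod i1,
      intervalIntegral_intervalIntegral_eq_prod i2, ← integral_add i1 i2,
      ← sub_zero (∫ p, _ + _ ∂_), ← mul_zero (2 * ((m : ℝ) + 1) ^ a),
      ← integral_mul_mul_eq_zero hzero, ← integral_const_mul,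
      ← integral_sub (by exact i1.add i2) (i3.const_mul _)]
    refine integral_congr_ae ?_
    filter_upwards [ae_abs_sub_lt_one] with p hp
    have hs := (hasSum_abs_rpow_symm a (r := (m : ℝ) + 1) (by simp) hp).mul_left (φ p.1 * φ p.2)
    calc _ = ∑' l : ℕ, φ p.1 * φ p.2 * (2 * genBinom a (2 * (l + 1)) *
          ((m : ℝ) + 1) ^ (a - 2 * (l + 1)) * (p.1 - p.2) ^ (2 * (l + 1))) :=
          tsum_congr fun l => by simp only [hA]; ring
      _ = _ := by rw [hs.tsum_eq, sub_eq_add_neg (p.1 - p.2) ((m : ℝ) + 1)]; ring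
  rw [e2] at h
  simpa only [e1] using h

theorem hasSum_sum_shiftedCovariance {φ : ℝ → ℝ} (hmeas : Measurable φ) {M : ℝ}
    (hbdd : ∀ x, |φ x| ≤ M) (hzero : (∫ t in (0 : ℝ)..1, φ t) = 0)
    {a : ℝ} (ha : -1 < a) (ha0 : a < 0) :
    HasSum (fun m : ℕ => shiftedCovariance φ a (m + 1) + shiftedCovariance φ a (-(m + 1)))
      (∑' l : ℕ, 2 * genBinom a (2 * (l + 1)) * zetaReal (2 * (l + 1) - a) * evenMoment φ l) := by
  set F : ℕ → ℕ → ℝ := fun m l =>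
    2 * genBinom a (2 * (l + 1)) * ((m : ℝ) + 1) ^ (a - 2 * (l + 1)) * evenMoment φ l with hF
  have hsum : Summable (Function.uncurry F) := by
    have h := (summable_one_div_nat_add_one_sq.mul_left 2).mul_of_nonneg
      (summable_one_div_nat_add_one_sq.mul_left (M ^ 2))
      (fun _ => by positivity) (fun _ => by positivity)
    refine Summable.of_norm_bounded h fun p => ?_
    rw [Function.uncurry, norm_mul]
    exact mul_le_mul (abs_coeff_le ha ha0 _ _) (abs_evenMoment_le hmeas hbdd _)
      (norm_nonneg _) (by positivity)
  have h := hsum.hasSum.prod_fiberwise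
    fun m => hasSum_shiftedCovariance_symm hmeas hbdd hzero ha ha0 m
  convert h using 1
  rw [hsum.tsum_prod' fun m =>
    (hasSum_shiftedCovariance_symm hmeas hbdd hzero ha ha0 m).summable]
  simp only [Function.uncurry]
  rw [← hsum.tsum_comm]
  refine tsum_congr fun l => ?_
  simp only [hF, zetaReal, neg_sub]
  rw [tsum_mul_right, tsum_mul_left]

theorem averaged_covariance_limit (H : ℝ) (hH : H ∈ Set.Ioo (1/2 : ℝ) 1)
    (φ : ℝ → ℝ) (hmeas : Measurable φ) (M : ℝ) (hbdd : ∀ x, |φ x| ≤ M)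
    (hper : ∀ x, φ (x + 1) = φ x)
    (hzero : (∫ t in (0:ℝ)..1, φ t) = 0) :
    Tendsto
      (fun n : ℕ =>
        (1 / (n : ℝ)) * ∫ t in (0:ℝ)..(n:ℝ), ∫ s in (0:ℝ)..(n:ℝ),
          φ t * φ s * |t - s| ^ (2 * H - 2))
      atTop
      (nhds ((∫ t in (0:ℝ)..1, ∫ s in (0:ℝ)..1, φ t * φ s * |t - s| ^ (2 * H - 2)) +
        ∑' l : ℕ, 2 * genBinom (2 * H - 2) (2 * (l + 1)) *
          zetaReal (2 * (l + 1) + 2 - 2 * H) *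
          ∫ t in (0:ℝ)..1, ∫ s in (0:ℝ)..1, φ t * φ s * (t - s) ^ (2 * (l + 1)))) := by
  have ha : -1 < 2 * H - 2 := by linarith [hH.1]
  have ha0 : 2 * H - 2 < 0 := by linarith [hH.2]
  have h := (((hasSum_sum_shiftedCovariance hmeas hbdd hzero ha ha0).tendsto_sum_nat).const_add
    (shiftedCovariance φ (2 * H - 2) 0)).cesaro
  have e : ∀ l : ℕ, 2 * ((l : ℝ) + 1) - (2 * H - 2) = 2 * (l + 1) + 2 - 2 * H := fun l => by ring
  simp_rw [e] at h
  have e0 : shiftedCovariance φ (2 * H - 2) 0 =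
      ∫ t in (0:ℝ)..1, ∫ s in (0:ℝ)..1, φ t * φ s * |t - s| ^ (2 * H - 2) := by
    simp [shiftedCovariance]
  rw [← e0]
  refine h.congr fun n => ?_
  rw [integral_integral_eq_sum_shiftedCovariance hmeas hbdd hper ha,
    sum_sum_sub_eq (fun k : ℤ => shiftedCovariance φ (2 * H - 2) k), one_div]
  simp
end

section
/- Let H ∈ (1/2, 1) and let φ : ℝ → ℝ be a bounded measurable 1-periodic function with ∫₀¹ φ(t) dt = 0. Then ∫₀¹ ∫₀¹ φ(t) φ(s) |t−s|^{2H−2} dt ds + Σ_{l=1}^∞ 2·C(2H−2, 2l)·ζ(2l+2−2H)·∫₀¹ ∫₀¹ φ(t) φ(s) (t−s)^{2l} dt ds = (1/Γ(2−2H)) ∫₀¹ ∫₀¹ φ(t) φ(s) ∫₀^∞ (u^{1−2H}/(e^u − 1)) · (e^{u(1−|t−s|)} + e^{u|t−s|} − 2) du dt ds, where C(2H−2, 2l) denotes the generalized binomial coefficient (2H−2)(2H−3)⋯(2H−2−(2l−1)) / (2l)!, ζ is the Riemann zeta function, and Γ is the Gamma function. -/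
open Real MeasureTheory

/-- A series of integrable functions whose `L¹` norms are summable has an integrable sum. -/
lemma integrable_tsum_of_summable_integral_norm {α : Type*} [MeasurableSpace α] {μ : Measure α}
    {F : ℕ → α → ℝ} (hF : ∀ i, Integrable (F i) μ)
    (hsum : Summable fun i => ∫ x, ‖F i x‖ ∂μ) :
    Integrable (fun x => ∑' i, F i x) μ := by
  refine ⟨(AEMeasurable.tsum fun i => (hF i).aemeasurable).aestronglyMeasurable, ?_⟩
  calc ∫⁻ x, ‖∑' i, F i x‖ₑ ∂μ ≤ ∫⁻ x, ∑' i, ‖F i x‖ₑ ∂μ :=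
        lintegral_mono fun x => enorm_tsum_le_tsum_enorm
    _ = ∑' i, ∫⁻ x, ‖F i x‖ₑ ∂μ := lintegral_tsum fun i => (hF i).1.enorm
    _ = ∑' i, ENNReal.ofReal (∫ x, ‖F i x‖ ∂μ) :=
        tsum_congr fun i => (ofReal_integral_norm_eq_lintegral_enorm (hF i)).symm
    _ = ENNReal.ofReal (∑' i, ∫ x, ‖F i x‖ ∂μ) :=
        (ENNReal.ofReal_tsum_of_nonneg (fun i => integral_nonneg fun x => norm_nonneg _) hsum).symm
    _ < ⊤ := ENNReal.ofReal_lt_top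

lemma summable_zetaReal {s : ℝ} (hs : 1 < s) : Summable fun m : ℕ => ((m : ℝ) + 1) ^ (-s) := by
  have h := (summable_nat_add_iff 1).mpr (Real.summable_nat_rpow.mpr (neg_lt_neg hs))
  simpa using h

lemma zetaReal_nonneg (s : ℝ) : 0 ≤ zetaReal s :=
  tsum_nonneg fun m => by positivity

lemma zetaReal_le_zetaReal {s t : ℝ} (hs : 1 < s) (hst : s ≤ t) : zetaReal t ≤ zetaReal s :=
  (summable_zetaReal (hs.trans_le hst)).tsum_le_tsum
    (fun m => Real.rpow_le_rpow_of_exponent_le (by simp) (neg_le_neg hst)) (summable_zetaReal hs)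

lemma integrableOn_rpow_mul_exp_neg_mul_Ioi {s r : ℝ} (hs : 0 < s) (hr : 0 < r) :
    IntegrableOn (fun u : ℝ => u ^ (s - 1) * Real.exp (-(r * u))) (Set.Ioi 0) := by
  refine Integrable.of_integral_ne_zero ?_
  rw [Real.integral_rpow_mul_exp_neg_mul_Ioi hs hr]
  have := Real.Gamma_pos_of_pos hs
  positivity

lemma hasSum_exp_neg_nat_add_one_mul {u : ℝ} (hu : 0 < u) :
    HasSum (fun n : ℕ => Real.exp (-(((n : ℝ) + 1) * u))) (Real.exp u - 1)⁻¹ := by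
  have h1 : Real.exp (-u) < 1 := Real.exp_lt_one_iff.mpr (by linarith)
  have h := (hasSum_geometric_of_lt_one (Real.exp_pos _).le h1).mul_left (Real.exp (-u))
  convert! h using 1
  · ext n
    rw [← Real.exp_nat_mul, ← Real.exp_add]
    ring_nf
  · rw [Real.exp_neg] at h1 ⊢
    have h2 : (1 : ℝ) < Real.exp u := Real.one_lt_exp_iff.mpr hu
    have h3 : Real.exp u - 1 ≠ 0 := by linarith
    have h4 : 1 - (Real.exp u)⁻¹ ≠ 0 := by linarith
    field_simp

/-- The Bose–Einstein integral. -/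
lemma bose_integral {s : ℝ} (hs : 1 < s) :
    IntegrableOn (fun u : ℝ => u ^ (s - 1) / (Real.exp u - 1)) (Set.Ioi 0) ∧
      ∫ u in Set.Ioi (0 : ℝ), u ^ (s - 1) / (Real.exp u - 1) = Real.Gamma s * zetaReal s := by
  have hs0 : 0 < s := by linarith
  set F : ℕ → ℝ → ℝ := fun n u => u ^ (s - 1) * Real.exp (-(((n : ℝ) + 1) * u))
  have hF (n : ℕ) : Integrable (F n) (volume.restrict (Set.Ioi 0)) :=
    integrableOn_rpow_mul_exp_neg_mul_Ioi hs0 (by positivity)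
  have hint (n : ℕ) : ∫ u in Set.Ioi (0 : ℝ), F n u = Real.Gamma s * ((n : ℝ) + 1) ^ (-s) := by
    rw [Real.integral_rpow_mul_exp_neg_mul_Ioi hs0 (by positivity), one_div,
      Real.inv_rpow (by positivity), ← Real.rpow_neg (by positivity), mul_comm]
  have hnorm (n : ℕ) : ∫ u in Set.Ioi (0 : ℝ), ‖F n u‖ = ∫ u in Set.Ioi (0 : ℝ), F n u :=
    setIntegral_congr_fun measurableSet_Ioi fun u hu =>
      Real.norm_of_nonneg (mul_nonneg (Real.rpow_nonneg (le_of_lt hu) _) (Real.exp_pos _).le)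
  have hsum : Summable fun n => ∫ u in Set.Ioi (0 : ℝ), ‖F n u‖ := by
    simp_rw [hnorm, hint]
    exact (summable_zetaReal hs).mul_left _
  have htsum : Set.EqOn (fun u => ∑' n, F n u) (fun u : ℝ => u ^ (s - 1) / (Real.exp u - 1))
      (Set.Ioi 0) := fun u hu =>
    ((hasSum_exp_neg_nat_add_one_mul hu).mul_left (u ^ (s - 1))).tsum_eq
  refine ⟨IntegrableOn.congr_fun (integrable_tsum_of_summable_integral_norm hF hsum) htsum
    measurableSet_Ioi, ?_⟩
  rw [← setIntegral_congr_fun measurableSet_Ioi htsum,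
    ← (hasSum_integral_of_summable_integral_norm hF hsum).tsum_eq]
  simp_rw [hint]
  rw [tsum_mul_left, zetaReal]

lemma Gamma_add_natCast_eq_mul_prod {a : ℝ} (ha : 0 < a) (n : ℕ) :
    Real.Gamma (a + n) = Real.Gamma a * ∏ i ∈ Finset.range n, (a + i) := by
  induction n with
  | zero => simp
  | succ n ih =>
    rw [Finset.prod_range_succ, ← mul_assoc, ← ih, Nat.cast_succ, ← add_assoc,
      Real.Gamma_add_one (by positivity), mul_comm]

lemma genBinom_neg_even (a : ℝ) (l : ℕ) :
    genBinom (-a) (2 * l) = (∏ i ∈ Finset.range (2 * l), (a + i)) / ((2 * l).factorial : ℝ) := by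
  rw [genBinom]
  congr 1
  calc ∏ i ∈ Finset.range (2 * l), (-a - (i : ℝ))
      = ∏ i ∈ Finset.range (2 * l), (-1) * (a + (i : ℝ)) :=
        Finset.prod_congr rfl fun i _ => by ring
    _ = _ := by rw [Finset.prod_mul_distrib]; simp

lemma genBinom_neg_even_nonneg {a : ℝ} (ha : 0 ≤ a) (l : ℕ) : 0 ≤ genBinom (-a) (2 * l) := by
  rw [genBinom_neg_even]
  exact div_nonneg (Finset.prod_nonneg fun i _ => by positivity) (by positivity)

lemma genBinom_neg_even_le_one {a : ℝ} (ha : 0 ≤ a) (ha1 : a ≤ 1) (l : ℕ) :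
    genBinom (-a) (2 * l) ≤ 1 := by
  rw [genBinom_neg_even, div_le_one (by positivity), ← Finset.prod_range_add_one_eq_factorial]
  push_cast
  exact Finset.prod_le_prod (fun i _ => by positivity) fun i _ => by linarith

/-- The coefficient of `x ^ (2 * (l + 1))` in the expansion of the Bose kernel. -/
noncomputable def boseCoeff (a : ℝ) (l : ℕ) : ℝ :=
  2 * genBinom (-a) (2 * (l + 1)) * zetaReal (2 * (l + 1) + a)

lemma boseCoeff_nonneg {a : ℝ} (ha : 0 ≤ a) (l : ℕ) : 0 ≤ boseCoeff a l :=
  mul_nonneg (mul_nonneg two_pos.le (genBinom_neg_even_nonneg ha _)) (zetaReal_nonneg _)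

lemma boseCoeff_le {a : ℝ} (ha : 0 ≤ a) (ha1 : a ≤ 1) (l : ℕ) :
    boseCoeff a l ≤ 2 * zetaReal 2 := by
  have h1 := genBinom_neg_even_le_one ha ha1 (l + 1)
  have h2 : zetaReal (2 * (l + 1) + a) ≤ zetaReal 2 :=
    zetaReal_le_zetaReal one_lt_two (by nlinarith [(Nat.cast_nonneg l : (0 : ℝ) ≤ l)])
  exact mul_le_mul (by linarith) h2 (zetaReal_nonneg _) two_pos.le

lemma hasSum_two_mul_cosh_sub_two (y : ℝ) :
    HasSum (fun l : ℕ => 2 * y ^ (2 * (l + 1)) / ((2 * (l + 1)).factorial : ℝ))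
      (2 * Real.cosh y - 2) := by
  have h := ((hasSum_nat_add_iff' 1).mpr (Real.hasSum_cosh y)).mul_left 2
  convert! h using 1
  · ext l
    ring
  · simp
    ring

/-- Expansion of the Bose kernel in powers of `x`. -/
lemma bose_kernel_integral {a x : ℝ} (ha : 0 < a) (ha1 : a ≤ 1) (hx : 0 < x) (hx1 : x < 1) :
    ∫ u in Set.Ioi (0 : ℝ), u ^ (a - 1) / (Real.exp u - 1) *
        (Real.exp (u * (1 - x)) + Real.exp (u * x) - 2) =
      Real.Gamma a * (x ^ (-a) + ∑' l, boseCoeff a l * x ^ (2 * (l + 1))) := by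
  set F : ℕ → ℝ → ℝ := fun l u => 2 * x ^ (2 * (l + 1)) / ((2 * (l + 1)).factorial : ℝ) *
    (u ^ (a + ((2 * (l + 1) : ℕ) : ℝ) - 1) / (Real.exp u - 1))
  have hs (l : ℕ) : 1 < a + ((2 * (l + 1) : ℕ) : ℝ) := by
    push_cast
    nlinarith [(Nat.cast_nonneg l : (0 : ℝ) ≤ l)]
  have hF (l : ℕ) : Integrable (F l) (volume.restrict (Set.Ioi 0)) :=
    (bose_integral (hs l)).1.const_mul _
  have hint (l : ℕ) : ∫ u in Set.Ioi (0 : ℝ), F l u =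
      Real.Gamma a * (boseCoeff a l * x ^ (2 * (l + 1))) := by
    rw [integral_const_mul, (bose_integral (hs l)).2, Gamma_add_natCast_eq_mul_prod ha, boseCoeff,
      genBinom_neg_even]
    push_cast
    rw [add_comm a]
    ring
  have hnorm (l : ℕ) : ∫ u in Set.Ioi (0 : ℝ), ‖F l u‖ = ∫ u in Set.Ioi (0 : ℝ), F l u :=
    setIntegral_congr_fun measurableSet_Ioi fun u (hu : 0 < u) =>
      Real.norm_of_nonneg (mul_nonneg (by positivity)
        (div_nonneg (by positivity) (sub_nonneg.mpr (Real.one_le_exp hu.le))))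
  have hgeom : Summable fun l : ℕ => boseCoeff a l * x ^ (2 * (l + 1)) := by
    have hx2 : x ^ 2 < 1 := by nlinarith
    refine .of_nonneg_of_le (fun l => mul_nonneg (boseCoeff_nonneg ha.le l) (by positivity))
      (fun l => ?_) (((summable_nat_add_iff 1).mpr
        (summable_geometric_of_lt_one (sq_nonneg x) hx2)).mul_left (2 * zetaReal 2))
    rw [pow_mul]
    exact mul_le_mul_of_nonneg_right (boseCoeff_le ha.le ha1 l) (by positivity)
  have hsum : Summable fun l => ∫ u in Set.Ioi (0 : ℝ), ‖F l u‖ := by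
    simp_rw [hnorm, hint]
    exact hgeom.mul_left _
  have hEq : Set.EqOn (fun u : ℝ => u ^ (a - 1) / (Real.exp u - 1) *
        (Real.exp (u * (1 - x)) + Real.exp (u * x) - 2))
      (fun u => u ^ (a - 1) * Real.exp (-(x * u)) + ∑' l, F l u) (Set.Ioi 0) := by
    intro u (hu : 0 < u)
    have hS : HasSum (fun l => F l u)
        (u ^ (a - 1) / (Real.exp u - 1) * (2 * Real.cosh (x * u) - 2)) := by
      convert! (hasSum_two_mul_cosh_sub_two (x * u)).mul_left (u ^ (a - 1) / (Real.exp u - 1))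
        using 1
      ext l
      simp only [F]
      rw [add_sub_right_comm, Real.rpow_add hu, Real.rpow_natCast]
      ring
    have hne : Real.exp u - 1 ≠ 0 := by linarith [Real.one_lt_exp_iff.mpr hu]
    simp only
    rw [hS.tsum_eq, Real.cosh_eq, mul_one_sub, Real.exp_sub, Real.exp_neg, mul_comm u x]
    field_simp
    ring
  rw [setIntegral_congr_fun measurableSet_Ioi hEq,
    integral_add (integrableOn_rpow_mul_exp_neg_mul_Ioi ha hx)
      (integrable_tsum_of_summable_integral_norm hF hsum),
    Real.integral_rpow_mul_exp_neg_mul_Ioi ha hx,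
    ← (hasSum_integral_of_summable_integral_norm hF hsum).tsum_eq]
  simp_rw [hint]
  rw [tsum_mul_left, one_div, Real.inv_rpow hx.le, ← Real.rpow_neg hx.le]
  ring

lemma integral_abs_sub_rpow {p : ℝ} (hp : -1 < p) {t : ℝ} (ht : t ∈ Set.Ioc (0 : ℝ) 1) :
    IntervalIntegrable (fun s => |t - s| ^ p) volume 0 1 ∧
      ∫ s in (0 : ℝ)..1, |t - s| ^ p = (t ^ (p + 1) + (1 - t) ^ (p + 1)) / (p + 1) := by
  have hp0 : p + 1 ≠ 0 := by linarith
  have hl : Set.EqOn (fun s => (t - s) ^ p) (fun s => |t - s| ^ p) (Set.uIcc 0 t) := by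
    intro s hs
    rw [Set.uIcc_of_le ht.1.le] at hs
    simp only
    rw [abs_of_nonneg (by linarith [hs.2])]
  have hr : Set.EqOn (fun s => (s - t) ^ p) (fun s => |t - s| ^ p) (Set.uIcc t 1) := by
    intro s hs
    rw [Set.uIcc_of_le ht.2] at hs
    simp only
    rw [abs_sub_comm, abs_of_nonneg (by linarith [hs.1])]
  have hil : IntervalIntegrable (fun s => |t - s| ^ p) volume 0 t := by
    refine IntervalIntegrable.congr (fun s hs => hl (Set.uIoc_subset_uIcc hs)) ?_
    have h := (intervalIntegral.intervalIntegrable_rpow' (a := t) (b := 0) hp).comp_sub_left t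
    simpa using h
  have hir : IntervalIntegrable (fun s => |t - s| ^ p) volume t 1 := by
    refine IntervalIntegrable.congr (fun s hs => hr (Set.uIoc_subset_uIcc hs)) ?_
    have h := (intervalIntegral.intervalIntegrable_rpow' (a := 0) (b := 1 - t) hp).comp_sub_right t
    simpa using h
  refine ⟨hil.trans hir, ?_⟩
  rw [← intervalIntegral.integral_add_adjacent_intervals hil hir,
    ← intervalIntegral.integral_congr hl, ← intervalIntegral.integral_congr hr,
    intervalIntegral.integral_comp_sub_left (fun s => s ^ p),
    intervalIntegral.integral_comp_sub_right (fun s => s ^ p), integral_rpow (.inl hp),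
    integral_rpow (.inl hp)]
  simp [Real.zero_rpow hp0, add_div]

/-- Lebesgue measure on the unit square, as a product measure. -/
noncomputable abbrev unitSquareMeasure : Measure (ℝ × ℝ) :=
  (volume.restrict (Set.Ioc (0 : ℝ) 1)).prod (volume.restrict (Set.Ioc (0 : ℝ) 1))

lemma integral_unitSquareMeasure {f : ℝ × ℝ → ℝ} (hf : Integrable f unitSquareMeasure) :
    ∫ z, f z ∂unitSquareMeasure = ∫ t in (0 : ℝ)..1, ∫ s in (0 : ℝ)..1, f (t, s) := by
  simp_rw [integral_prod f hf, intervalIntegral.integral_of_le zero_le_one]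

lemma measurable_abs_sub_rpow (p : ℝ) : Measurable fun z : ℝ × ℝ => |z.1 - z.2| ^ p := by
  have h : Measurable fun z : ℝ × ℝ => |z.1 - z.2| := by fun_prop
  exact h.pow_const p

lemma integrable_abs_sub_rpow_s9 {p : ℝ} (hp : -1 < p) :
    Integrable (fun z : ℝ × ℝ => |z.1 - z.2| ^ p) unitSquareMeasure := by
  rw [integrable_prod_iff (measurable_abs_sub_rpow p).aestronglyMeasurable]
  constructor
  · filter_upwards [ae_restrict_mem measurableSet_Ioc] with t ht
    exact (intervalIntegrable_iff_integrableOn_Ioc_of_le zero_le_one).mp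
      (integral_abs_sub_rpow hp ht).1
  · have h0 : IntervalIntegrable (fun t : ℝ => t ^ (p + 1)) volume 0 1 :=
      intervalIntegral.intervalIntegrable_rpow' (by linarith)
    have h1 : IntervalIntegrable (fun t : ℝ => (1 - t) ^ (p + 1)) volume 0 1 := by
      simpa using (h0.comp_sub_left 1).symm
    have h := (intervalIntegrable_iff_integrableOn_Ioc_of_le zero_le_one).mp
      ((h0.add h1).div_const (p + 1))
    refine IntegrableOn.congr_fun h (fun t ht => ?_) measurableSet_Ioc
    simp only
    rw [← intervalIntegral.integral_of_le zero_le_one]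
    simp only [Real.norm_of_nonneg (Real.rpow_nonneg (abs_nonneg _) p)]
    exact (integral_abs_sub_rpow hp ht).2.symm

lemma integral_unitSquare_abs_sub_rpow {p : ℝ} (hp : -1 < p) :
    ∫ z : ℝ × ℝ, |z.1 - z.2| ^ p ∂unitSquareMeasure = 2 / ((p + 1) * (p + 2)) := by
  have hp1 : p + 1 ≠ 0 := by linarith
  have hp2 : p + 2 ≠ 0 := by linarith
  have h0 : IntervalIntegrable (fun t : ℝ => t ^ (p + 1)) volume 0 1 :=
    intervalIntegral.intervalIntegrable_rpow' (by linarith)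
  have h1 : IntervalIntegrable (fun t : ℝ => (1 - t) ^ (p + 1)) volume 0 1 := by
    simpa using (h0.comp_sub_left 1).symm
  rw [integral_unitSquareMeasure (integrable_abs_sub_rpow_s9 hp)]
  calc ∫ t in (0 : ℝ)..1, ∫ s in (0 : ℝ)..1, |t - s| ^ p
      = ∫ t in (0 : ℝ)..1, (t ^ (p + 1) + (1 - t) ^ (p + 1)) / (p + 1) := by
        rw [intervalIntegral.integral_of_le zero_le_one,
          intervalIntegral.integral_of_le zero_le_one]
        exact setIntegral_congr_fun measurableSet_Ioc fun t ht => (integral_abs_sub_rpow hp ht).2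
    _ = 2 / ((p + 1) * (p + 2)) := by
        rw [intervalIntegral.integral_div, intervalIntegral.integral_add h0 h1,
          intervalIntegral.integral_comp_sub_left (fun s => s ^ (p + 1)),
          sub_self, sub_zero, integral_rpow (.inl (by linarith)),
          Real.one_rpow, Real.zero_rpow (by linarith), add_assoc, one_add_one_eq_two]
        field_simp
        norm_num

/-- The integral of a bounded density against `|t - s| ^ (-a)` plus a power series in `(t - s) ^ 2`
with bounded coefficients can be computed term by term. -/
lemma integral_mul_rpow_add_tsum {a : ℝ} (ha : a < 1) {c : ℕ → ℝ} {C : ℝ}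
    (hc : ∀ l, |c l| ≤ C) {g : ℝ × ℝ → ℝ} (hg : Measurable g) {B : ℝ} (hB : ∀ z, |g z| ≤ B) :
    (∫ t in (0 : ℝ)..1, ∫ s in (0 : ℝ)..1, g (t, s) * |t - s| ^ (-a)) +
        ∑' l, c l * ∫ t in (0 : ℝ)..1, ∫ s in (0 : ℝ)..1, g (t, s) * (t - s) ^ (2 * (l + 1)) =
      ∫ t in (0 : ℝ)..1, ∫ s in (0 : ℝ)..1,
        g (t, s) * (|t - s| ^ (-a) + ∑' l, c l * |t - s| ^ (2 * (l + 1))) := by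
  have hB0 : 0 ≤ B := (abs_nonneg _).trans (hB 0)
  have hC0 : 0 ≤ C := (abs_nonneg _).trans (hc 0)
  have hgi {f : ℝ × ℝ → ℝ} (hf : Integrable f unitSquareMeasure) :
      Integrable (fun z => g z * f z) unitSquareMeasure :=
    hf.bdd_mul hg.aestronglyMeasurable (.of_forall hB)
  have hp (l : ℕ) : (-1 : ℝ) < ((2 * (l + 1) : ℕ) : ℝ) :=
    neg_one_lt_zero.trans_le (Nat.cast_nonneg _)
  have hpow (l : ℕ) : Integrable (fun z : ℝ × ℝ => |z.1 - z.2| ^ (2 * (l + 1)))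
      unitSquareMeasure := by
    simpa only [Real.rpow_natCast] using integrable_abs_sub_rpow_s9 (hp l)
  have hpow_int (l : ℕ) : ∫ z : ℝ × ℝ, |z.1 - z.2| ^ (2 * (l + 1)) ∂unitSquareMeasure =
      2 / ((((2 * (l + 1) : ℕ) : ℝ) + 1) * (((2 * (l + 1) : ℕ) : ℝ) + 2)) := by
    simpa only [Real.rpow_natCast] using integral_unitSquare_abs_sub_rpow (hp l)
  have h0 : Integrable (fun z : ℝ × ℝ => g z * |z.1 - z.2| ^ (-a)) unitSquareMeasure :=
    hgi (integrable_abs_sub_rpow_s9 (by linarith))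
  set F : ℕ → ℝ × ℝ → ℝ := fun l z => c l * (g z * |z.1 - z.2| ^ (2 * (l + 1)))
  have hF (l : ℕ) : Integrable (F l) unitSquareMeasure := (hgi (hpow l)).const_mul _
  have hsum : Summable fun l => ∫ z, ‖F l z‖ ∂unitSquareMeasure := by
    refine .of_nonneg_of_le (fun l => integral_nonneg fun z => norm_nonneg _) (fun l => ?_)
      (((summable_nat_add_iff 1).mpr
        (Real.summable_one_div_nat_pow.mpr one_lt_two)).mul_left (C * B))
    calc ∫ z, ‖F l z‖ ∂unitSquareMeasure
        ≤ ∫ z : ℝ × ℝ, C * B * |z.1 - z.2| ^ (2 * (l + 1)) ∂unitSquareMeasure := by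
          refine integral_mono (hF l).norm ((hpow l).const_mul _) fun z => ?_
          simp only [F]
          rw [norm_mul, norm_mul, norm_pow, Real.norm_eq_abs |_|, abs_abs, ← mul_assoc]
          gcongr
          exacts [hc l, hB z]
      _ ≤ C * B * (1 / ((l + 1 : ℕ) : ℝ) ^ 2) := by
          rw [integral_const_mul, hpow_int]
          refine mul_le_mul_of_nonneg_left ?_ (by positivity)
          rw [div_le_div_iff₀ (by positivity) (by positivity)]
          push_cast
          nlinarith [(Nat.cast_nonneg l : (0 : ℝ) ≤ l)]
  have hS := integrable_tsum_of_summable_integral_norm hF hsum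
  have hF_int (l : ℕ) : ∫ z, F l z ∂unitSquareMeasure =
      c l * ∫ t in (0 : ℝ)..1, ∫ s in (0 : ℝ)..1, g (t, s) * (t - s) ^ (2 * (l + 1)) := by
    rw [integral_const_mul, integral_unitSquareMeasure (hgi (hpow l))]
    simp only [pow_mul, sq_abs]
  have hsplit : (fun z : ℝ × ℝ => g z * (|z.1 - z.2| ^ (-a) +
      ∑' l, c l * |z.1 - z.2| ^ (2 * (l + 1)))) =
      fun z => g z * |z.1 - z.2| ^ (-a) + ∑' l, F l z := by
    ext z
    rw [mul_add, ← tsum_mul_left]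
    simp only [F, mul_left_comm]
  have hR := integral_unitSquareMeasure
    ((h0.add hS).congr (.of_forall fun z => (congrFun hsplit z).symm))
  dsimp only at hR
  rw [← hR, hsplit, integral_add h0 hS, integral_unitSquareMeasure h0,
    ← (hasSum_integral_of_summable_integral_norm hF hsum).tsum_eq]
  simp only [hF_int]

theorem variance_integral_representation (H : ℝ) (hH : H ∈ Set.Ioo (1/2 : ℝ) 1)
    (φ : ℝ → ℝ) (hmeas : Measurable φ) (M : ℝ) (hbdd : ∀ x, |φ x| ≤ M)
    (hper : ∀ x, φ (x + 1) = φ x)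
    (hzero : (∫ t in (0:ℝ)..1, φ t) = 0) :
    (∫ t in (0:ℝ)..1, ∫ s in (0:ℝ)..1, φ t * φ s * |t - s| ^ (2 * H - 2)) +
      (∑' l : ℕ, 2 * genBinom (2 * H - 2) (2 * (l + 1)) *
        zetaReal (2 * (l + 1) + 2 - 2 * H) *
        ∫ t in (0:ℝ)..1, ∫ s in (0:ℝ)..1, φ t * φ s * (t - s) ^ (2 * (l + 1)))
    = (1 / Real.Gamma (2 - 2 * H)) *
        ∫ t in (0:ℝ)..1, ∫ s in (0:ℝ)..1, φ t * φ s *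
          ∫ u in Set.Ioi (0:ℝ), u ^ (1 - 2 * H) / (Real.exp u - 1) *
            (Real.exp (u * (1 - |t - s|)) + Real.exp (u * |t - s|) - 2) := by
  obtain ⟨hH0, hH1⟩ := hH
  obtain ⟨a, ha⟩ : ∃ a, a = 2 - 2 * H := ⟨_, rfl⟩
  have ha0 : 0 < a := by linarith
  have ha1 : a < 1 := by linarith
  have hM : 0 ≤ M := (abs_nonneg _).trans (hbdd 0)
  have e1 : 2 * H - 2 = -a := by linarith
  have e2 (l : ℕ) : 2 * ((l : ℝ) + 1) + 2 - 2 * H = 2 * (l + 1) + a := by linarith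
  have e3 : 1 - 2 * H = a - 1 := by linarith
  simp_rw [e2]
  rw [e1, e3, ← ha]
  have hkernel : ∫ t in (0:ℝ)..1, ∫ s in (0:ℝ)..1, φ t * φ s *
        ∫ u in Set.Ioi (0:ℝ), u ^ (a - 1) / (Real.exp u - 1) *
          (Real.exp (u * (1 - |t - s|)) + Real.exp (u * |t - s|) - 2) =
      ∫ t in (0:ℝ)..1, ∫ s in (0:ℝ)..1, Real.Gamma a * (φ t * φ s *
        (|t - s| ^ (-a) + ∑' l, boseCoeff a l * |t - s| ^ (2 * (l + 1)))) := by
    simp_rw [intervalIntegral.integral_of_le (zero_le_one (α := ℝ))]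
    refine setIntegral_congr_fun measurableSet_Ioc fun t ht => integral_congr_ae ?_
    filter_upwards [ae_restrict_mem measurableSet_Ioc,
      ae_restrict_of_ae (Measure.ae_ne volume t)] with s hs hst
    have h0 : 0 < |t - s| := abs_pos.mpr (sub_ne_zero.mpr hst.symm)
    have h1 : |t - s| < 1 := abs_lt.mpr ⟨by linarith [ht.1, hs.2], by linarith [ht.2, hs.1]⟩
    rw [bose_kernel_integral ha0 ha1.le h0 h1]
    ring
  have hterm := integral_mul_rpow_add_tsum ha1 (c := boseCoeff a) (C := 2 * zetaReal 2)
    (fun l => (abs_of_nonneg (boseCoeff_nonneg ha0.le l)).trans_le (boseCoeff_le ha0.le ha1.le l))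
    (g := fun z => φ z.1 * φ z.2)
    ((hmeas.comp measurable_fst).mul (hmeas.comp measurable_snd)) (B := M * M)
    (fun z => (abs_mul _ _).trans_le (mul_le_mul (hbdd _) (hbdd _) (abs_nonneg _) hM))
  rw [hkernel]
  simp_rw [intervalIntegral.integral_const_mul (Real.Gamma a)]
  rw [← mul_assoc, one_div_mul_cancel (Real.Gamma_pos_of_pos ha0).ne', one_mul]
  exact hterm
end

section
/- Let H ∈ (1/2, 1) and let φ : ℝ → ℝ be a bounded measurable 1-periodic function with ∫₀¹ φ(t) dt = 0 which is not almost everywhere zero on [0,1]. Then (1/Γ(2−2H)) ∫₀¹ ∫₀¹ φ(t) φ(s) ∫₀^∞ (u^{1−2H}/(e^u − 1)) · (e^{u(1−|t−s|)} + e^{u|t−s|} − 2) du dt ds > 0. -/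
open Real MeasureTheory

/-- Lebesgue measure on the unit interval. -/
noncomputable abbrev unitVolume : Measure ℝ := volume.restrict (Set.Ioc 0 1)

/-- Up to normalisation, `t ↦ exp (-u * fract (t - r))` for `t, r` in the unit interval. -/
noncomputable def periodicExp (u t r : ℝ) : ℝ :=
  exp (-(u * t)) * exp (u * r) * if r < t then 1 else exp (-u)

lemma integral_exp_mul_const {u : ℝ} (hu : u ≠ 0) (a b : ℝ) :
    ∫ r in a..b, exp (2 * u * r) = (exp (2 * u * b) - exp (2 * u * a)) / (2 * u) := by
  rw [intervalIntegral.integral_comp_mul_left (fun x => exp x) (by positivity), integral_exp]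
  simp [div_eq_inv_mul]

lemma measurable_periodicExp (u : ℝ) :
    Measurable fun p : ℝ × ℝ => periodicExp u p.1 p.2 := by
  unfold periodicExp
  refine Measurable.mul (by fun_prop) (Measurable.ite ?_ measurable_const measurable_const)
  exact measurableSet_lt measurable_snd measurable_fst

lemma abs_periodicExp_le {u t r : ℝ} (hu : 0 < u) (ht : 0 ≤ t) (hr : r ≤ 1) :
    |periodicExp u t r| ≤ exp u := by
  unfold periodicExp
  have h1 : exp (-(u * t)) ≤ 1 := exp_le_one_iff.2 (by nlinarith)
  have h2 : exp (u * r) ≤ exp u := exp_le_exp.2 (by nlinarith)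
  have h3 : (if r < t then 1 else exp (-u)) ≤ 1 := by
    split_ifs
    · exact le_rfl
    · exact exp_le_one_iff.2 (by linarith)
  have h4 : 0 ≤ (if r < t then 1 else exp (-u)) := by split_ifs <;> positivity
  rw [abs_of_nonneg (by positivity)]
  calc _ ≤ 1 * exp u * 1 := by gcongr
    _ = exp u := by ring

lemma integral_periodicExp_mul_of_le {u t s : ℝ} (hu : 0 < u) (ht : 0 ≤ t) (hts : t ≤ s)
    (hs : s ≤ 1) :
    ∫ r in (0:ℝ)..1, periodicExp u t r * periodicExp u s r =
      (1 - exp (-u)) * exp (-u) / (2 * u) * (exp (u * (1 - (s - t))) + exp (u * (s - t))) := by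
  have key : ∀ a b c : ℝ, a ≤ b →
      (∀ r ∈ Set.Ioo a b, (if r < t then 1 else exp (-u)) * (if r < s then 1 else exp (-u)) = c) →
      Set.EqOn (fun r => periodicExp u t r * periodicExp u s r)
        (fun r => exp (-(u * t)) * exp (-(u * s)) * c * exp (2 * u * r)) (Set.Ioo a b) := by
    intro a b c hab h r hr
    have h2 : exp (2 * u * r) = exp (u * r) * exp (u * r) := by rw [← exp_add]; ring_nf
    simp only [periodicExp, ← h r hr, h2]
    ring
  have int : ∀ a b c : ℝ, a ≤ b →
      (∀ r ∈ Set.Ioo a b, (if r < t then 1 else exp (-u)) * (if r < s then 1 else exp (-u)) = c) →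
      IntervalIntegrable (fun r => periodicExp u t r * periodicExp u s r) volume a b := by
    intro a b c hab h
    have : IntervalIntegrable (fun r => exp (-(u * t)) * exp (-(u * s)) * c * exp (2 * u * r))
      volume a b := Continuous.intervalIntegrable (by fun_prop) _ _
    rw [intervalIntegrable_iff_integrableOn_Ioo_of_le hab] at this ⊢
    exact this.congr_fun (key a b c hab h).symm measurableSet_Ioo
  have val : ∀ a b c : ℝ, a ≤ b →
      (∀ r ∈ Set.Ioo a b, (if r < t then 1 else exp (-u)) * (if r < s then 1 else exp (-u)) = c) →
      ∫ r in a..b, periodicExp u t r * periodicExp u s r =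
        exp (-(u * t)) * exp (-(u * s)) * c * ((exp (2 * u * b) - exp (2 * u * a)) / (2 * u)) := by
    intro a b c hab h
    rw [intervalIntegral.integral_congr_Ioo_of_le hab (key a b c hab h),
      intervalIntegral.integral_const_mul, integral_exp_mul_const hu.ne']
  have h1 : ∀ r ∈ Set.Ioo 0 t,
      (if r < t then 1 else exp (-u)) * (if r < s then 1 else exp (-u)) = 1 := by
    intro r hr
    rw [if_pos hr.2, if_pos (hr.2.trans_le hts), one_mul]
  have h2 : ∀ r ∈ Set.Ioo t s,
      (if r < t then 1 else exp (-u)) * (if r < s then 1 else exp (-u)) = exp (-u) := by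
    intro r hr
    rw [if_neg hr.1.not_gt, if_pos hr.2, mul_one]
  have h3 : ∀ r ∈ Set.Ioo s 1,
      (if r < t then 1 else exp (-u)) * (if r < s then 1 else exp (-u)) =
        exp (-u) * exp (-u) := by
    intro r hr
    rw [if_neg (hts.trans_lt hr.1).not_gt, if_neg hr.1.not_gt]
  rw [← intervalIntegral.integral_add_adjacent_intervals
      ((int 0 t _ ht h1).trans (int t s _ hts h2)) (int s 1 _ hs h3),
    ← intervalIntegral.integral_add_adjacent_intervals (int 0 t _ ht h1) (int t s _ hts h2),
    val 0 t _ ht h1, val t s _ hts h2, val s 1 _ hs h3]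
  have e1 : exp (2 * u * t) = exp (u * t) ^ 2 := by rw [← exp_nat_mul]; ring_nf
  have e2 : exp (2 * u * s) = exp (u * s) ^ 2 := by rw [← exp_nat_mul]; ring_nf
  have e3 : exp (2 * u * 1) = exp u ^ 2 := by rw [← exp_nat_mul]; ring_nf
  have e4 : exp (u * (1 - (s - t))) = exp u * exp (u * t) / exp (u * s) := by
    rw [← exp_add, ← exp_sub]; ring_nf
  have e5 : exp (u * (s - t)) = exp (u * s) / exp (u * t) := by
    rw [← exp_sub]; ring_nf
  rw [e1, e2, e3, e4, e5, exp_neg, exp_neg, exp_neg, mul_zero, exp_zero]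
  have := exp_pos u
  have := exp_pos (u * t)
  have := exp_pos (u * s)
  field_simp
  ring

lemma integral_periodicExp_mul {u t s : ℝ} (hu : 0 < u) (ht : t ∈ Set.Ioc (0:ℝ) 1)
    (hs : s ∈ Set.Ioc (0:ℝ) 1) :
    ∫ r, periodicExp u t r * periodicExp u s r ∂unitVolume =
      (1 - exp (-u)) * exp (-u) / (2 * u) * (exp (u * (1 - |t - s|)) + exp (u * |t - s|)) := by
  rw [← intervalIntegral.integral_of_le zero_le_one]
  rcases le_total t s with h | h
  · rw [integral_periodicExp_mul_of_le hu ht.1.le h hs.2, abs_sub_comm,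
      abs_of_nonneg (sub_nonneg.2 h)]
  · simp_rw [mul_comm (periodicExp u t _)]
    rw [integral_periodicExp_mul_of_le hu hs.1.le h ht.2, abs_of_nonneg (sub_nonneg.2 h)]

lemma integrable_comp_abs_sub {h : ℝ → ℝ} (hh : IntervalIntegrable h volume 0 1) :
    Integrable (fun p : ℝ × ℝ => h |p.1 - p.2|) (unitVolume.prod unitVolume) := by
  have h1 : IntervalIntegrable (fun x => h |x|) volume 0 1 := by
    refine hh.congr fun x hx => ?_
    rw [Set.uIoc_of_le zero_le_one] at hx
    simp only [abs_of_pos hx.1]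
  have h2 : IntervalIntegrable (fun x => h |x|) volume (-1) 1 := by
    refine IntervalIntegrable.trans (b := 0) ?_ h1
    have := (IntervalIntegrable.iff_comp_neg (by simp)).1 h1
    simp only [abs_neg, neg_zero] at this
    exact this.symm
  rw [intervalIntegrable_iff_integrableOn_Ioc_of_le (by norm_num),
    ← integrable_indicator_iff measurableSet_Ioc] at h2
  have h3 : Integrable ((Set.Ioc (0:ℝ) 1).indicator fun _ => (1:ℝ)) :=
    (integrable_indicator_iff measurableSet_Ioc).2 (integrableOn_const (by simp))
  have h4 := (h3.convolution_integrand (ContinuousLinearMap.mul ℝ ℝ) h2).integrableOn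
    (s := Set.Ioc (0:ℝ) 1 ×ˢ Set.Ioc (0:ℝ) 1)
  rw [Measure.prod_restrict]
  refine h4.congr_fun ?_ (measurableSet_Ioc.prod measurableSet_Ioc)
  rintro ⟨t, s⟩ ⟨ht, hs⟩
  simp only [Set.mem_Ioc] at ht hs
  have : t - s ∈ Set.Ioc (-1:ℝ) 1 := ⟨by linarith, by linarith⟩
  simp [Set.indicator_of_mem this, Set.indicator_of_mem (show s ∈ Set.Ioc (0:ℝ) 1 from hs)]

lemma integrable_unitVolume_of_abs_le {f : ℝ → ℝ} (hf : Measurable f) {C : ℝ}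
    (hC : ∀ x ∈ Set.Ioc (0:ℝ) 1, |f x| ≤ C) : Integrable f unitVolume :=
  Integrable.of_bound hf.aestronglyMeasurable C <|
    (ae_restrict_iff' measurableSet_Ioc).2 (ae_of_all _ hC)

lemma ae_mem_unitSquare :
    ∀ᵐ p ∂(unitVolume.prod unitVolume), p.1 ∈ Set.Ioc (0:ℝ) 1 ∧ p.2 ∈ Set.Ioc (0:ℝ) 1 := by
  rw [Measure.prod_restrict]
  filter_upwards [ae_restrict_mem (measurableSet_Ioc.prod measurableSet_Ioc)] with p hp
  exact hp

lemma ae_eq_zero_of_forall_intervalIntegral_eq_zero {f : ℝ → ℝ}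
    (hf : IntervalIntegrable f volume 0 1)
    (h : ∀ r ∈ Set.Icc (0:ℝ) 1, ∫ t in (0:ℝ)..r, f t = 0) :
    ∀ᵐ x ∂(volume.restrict (Set.Icc (0:ℝ) 1)), f x = 0 := by
  rw [← restrict_Ioo_eq_restrict_Icc, ae_restrict_iff' measurableSet_Ioo]
  filter_upwards [hf.ae_hasDerivAt_integral] with x hx hxI
  have hx' := hx (by rw [Set.uIcc_of_le zero_le_one]; exact Set.Ioo_subset_Icc_self hxI) 0 (by simp)
  refine hx'.unique ((hasDerivAt_const x (0:ℝ)).congr_of_eventuallyEq ?_)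
  filter_upwards [Ioo_mem_nhds hxI.1 hxI.2] with y hy
  exact h y (Set.Ioo_subset_Icc_self hy)

lemma integral_mul_periodicExp {φ : ℝ → ℝ} {u r : ℝ}
    (hφ : IntervalIntegrable (fun t => φ t * exp (-(u * t))) volume 0 1)
    (hr : r ∈ Set.Icc (0:ℝ) 1) :
    ∫ t, φ t * periodicExp u t r ∂unitVolume =
      exp (u * r) * ((∫ t in (0:ℝ)..1, φ t * exp (-(u * t))) -
        (1 - exp (-u)) * ∫ t in (0:ℝ)..r, φ t * exp (-(u * t))) := by
  have i1 : IntervalIntegrable (fun t => φ t * exp (-(u * t))) volume 0 r :=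
    hφ.mono_set (by
      rw [Set.uIcc_of_le hr.1, Set.uIcc_of_le zero_le_one]; exact Set.Icc_subset_Icc_right hr.2)
  have i2 : IntervalIntegrable (fun t => φ t * exp (-(u * t))) volume r 1 :=
    hφ.mono_set (by
      rw [Set.uIcc_of_le hr.2, Set.uIcc_of_le zero_le_one]; exact Set.Icc_subset_Icc_left hr.1)
  have e1 : Set.EqOn (fun t => exp (u * r) * exp (-u) * (φ t * exp (-(u * t))))
      (fun t => φ t * periodicExp u t r) (Set.uIoc 0 r) := by
    intro t ht
    rw [Set.uIoc_of_le hr.1] at ht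
    simp only [periodicExp, if_neg ht.2.not_gt]
    ring
  have e2 : Set.EqOn (fun t => exp (u * r) * (φ t * exp (-(u * t))))
      (fun t => φ t * periodicExp u t r) (Set.uIoc r 1) := by
    intro t ht
    rw [Set.uIoc_of_le hr.2] at ht
    simp only [periodicExp, if_pos ht.1]
    ring
  rw [← intervalIntegral.integral_of_le zero_le_one,
    ← intervalIntegral.integral_add_adjacent_intervals ((i1.const_mul _).congr e1)
      ((i2.const_mul _).congr e2),
    ← intervalIntegral.integral_add_adjacent_intervals i1 i2,
    ← intervalIntegral.integral_congr_ae (ae_of_all _ e1),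
    ← intervalIntegral.integral_congr_ae (ae_of_all _ e2),
    intervalIntegral.integral_const_mul, intervalIntegral.integral_const_mul]
  ring

lemma integral_sq_integral_mul_periodicExp_pos {φ : ℝ → ℝ} (hmeas : Measurable φ) {M : ℝ}
    (hbdd : ∀ x, |φ x| ≤ M)
    (hne : ¬ (∀ᵐ x ∂(volume.restrict (Set.Icc (0:ℝ) 1)), φ x = 0)) {u : ℝ} (hu : 0 < u) :
    0 < ∫ r, (∫ t, φ t * periodicExp u t r ∂unitVolume) ^ 2 ∂unitVolume := by
  have hφ : IntervalIntegrable (fun t => φ t * exp (-(u * t))) volume 0 1 := by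
    rw [intervalIntegrable_iff_integrableOn_Ioc_of_le zero_le_one]
    refine integrable_unitVolume_of_abs_le (by fun_prop) (C := M * 1) fun x hx => ?_
    rw [abs_mul, abs_exp]
    exact mul_le_mul (hbdd x) (exp_le_one_iff.2 (by nlinarith [hx.1])) (exp_pos _).le
      ((abs_nonneg _).trans (hbdd x))
  set Φ : ℝ → ℝ := fun r => ∫ t in (0:ℝ)..r, φ t * exp (-(u * t)) with hΦ
  have hΦc : ContinuousOn Φ (Set.Icc 0 1) := by
    rw [← Set.uIcc_of_le zero_le_one]
    exact intervalIntegral.continuousOn_primitive_interval' hφ (by simp)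
  set G : ℝ → ℝ := fun r => exp (u * r) * (Φ 1 - (1 - exp (-u)) * Φ r) with hG
  have hGc : ContinuousOn G (Set.Icc 0 1) := by fun_prop
  have hFG : ∀ r ∈ Set.Icc (0:ℝ) 1, ∫ t, φ t * periodicExp u t r ∂unitVolume = G r :=
    fun r hr => integral_mul_periodicExp hφ hr
  have hint : ∫ r, (∫ t, φ t * periodicExp u t r ∂unitVolume) ^ 2 ∂unitVolume =
      ∫ r in Set.Icc (0:ℝ) 1, G r ^ 2 := by
    rw [integral_Icc_eq_integral_Ioc]
    exact setIntegral_congr_fun measurableSet_Ioc fun r hr => by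
      simp only [hFG r (Set.Ioc_subset_Icc_self hr)]
  have hGi : IntegrableOn (fun r => G r ^ 2) (Set.Icc 0 1) :=
    (hGc.pow 2).integrableOn_compact isCompact_Icc
  rw [hint]
  refine (integral_nonneg fun r => sq_nonneg (G r)).lt_of_ne' fun h0 => hne ?_
  rw [integral_eq_zero_iff_of_nonneg (fun r => sq_nonneg (G r)) hGi] at h0
  have hG0 : Set.EqOn G (fun _ => 0) (Set.Icc 0 1) := by
    refine Measure.eqOn_Icc_of_ae_eq volume zero_ne_one ?_ hGc continuousOn_const
    filter_upwards [h0] with r hr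
    simpa using hr
  have hΦr : ∀ r ∈ Set.Icc (0:ℝ) 1, Φ 1 = (1 - exp (-u)) * Φ r := fun r hr => by
    have := hG0 hr
    simp only [hG, mul_eq_zero, (exp_pos (u * r)).ne', false_or] at this
    linarith
  have hΦ1 : Φ 1 = 0 := by rw [hΦr 0 (by simp)]; simp [hΦ]
  have hpos : 1 - exp (-u) ≠ 0 := by
    have : exp (-u) < 1 := exp_lt_one_iff.2 (by linarith)
    linarith
  have hΦ0 : ∀ r ∈ Set.Icc (0:ℝ) 1, Φ r = 0 := fun r hr => by
    have := hΦr r hr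
    rw [hΦ1, zero_eq_mul] at this
    exact this.resolve_left hpos
  filter_upwards [ae_eq_zero_of_forall_intervalIntegral_eq_zero hφ hΦ0] with x hx
  exact (mul_eq_zero.1 hx).resolve_right (exp_pos _).ne'

lemma integral_mul_kernel_pos {φ : ℝ → ℝ} (hmeas : Measurable φ) {M : ℝ}
    (hbdd : ∀ x, |φ x| ≤ M) (hzero : ∫ t, φ t ∂unitVolume = 0)
    (hne : ¬ (∀ᵐ x ∂(volume.restrict (Set.Icc (0:ℝ) 1)), φ x = 0)) {u : ℝ} (hu : 0 < u) :
    0 < ∫ p : ℝ × ℝ, φ p.1 * φ p.2 *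
      (exp (u * (1 - |p.1 - p.2|)) + exp (u * |p.1 - p.2|) - 2) ∂(unitVolume.prod unitVolume) := by
  have hM : 0 ≤ M := (abs_nonneg _).trans (hbdd 0)
  have hc : 0 < (1 - exp (-u)) * exp (-u) / (2 * u) := by
    have : exp (-u) < 1 := exp_lt_one_iff.2 (by linarith)
    have : 0 < 1 - exp (-u) := by linarith
    positivity
  set c := (1 - exp (-u)) * exp (-u) / (2 * u)
  have hg := measurable_periodicExp u
  set F : (ℝ × ℝ) → ℝ → ℝ := fun p r =>
    (φ p.1 * periodicExp u p.1 r) * (φ p.2 * periodicExp u p.2 r)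
  have hFm : Measurable (Function.uncurry F) := by
    have h1 : Measurable fun q : (ℝ × ℝ) × ℝ => periodicExp u q.1.1 q.2 :=
      hg.comp (by fun_prop : Measurable fun q : (ℝ × ℝ) × ℝ => (q.1.1, q.2))
    have h2 : Measurable fun q : (ℝ × ℝ) × ℝ => periodicExp u q.1.2 q.2 :=
      hg.comp (by fun_prop : Measurable fun q : (ℝ × ℝ) × ℝ => (q.1.2, q.2))
    simp only [F, Function.uncurry_def]
    fun_prop
  have hFi : Integrable (Function.uncurry F) ((unitVolume.prod unitVolume).prod unitVolume) := by
    refine Integrable.of_bound hFm.aestronglyMeasurable ((M * exp u) * (M * exp u)) ?_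
    have hS : MeasurableSet ((Set.Ioc (0:ℝ) 1 ×ˢ Set.Ioc (0:ℝ) 1) ×ˢ Set.Ioc (0:ℝ) 1) :=
      (measurableSet_Ioc.prod measurableSet_Ioc).prod measurableSet_Ioc
    rw [Measure.prod_restrict, Measure.prod_restrict]
    filter_upwards [ae_restrict_mem hS] with q hq
    obtain ⟨⟨ht, hs⟩, hr⟩ := hq
    have b1 := abs_periodicExp_le hu ht.1.le hr.2
    have b2 := abs_periodicExp_le hu hs.1.le hr.2
    simp only [Function.uncurry_def, F, norm_mul, Real.norm_eq_abs]
    gcongr <;> apply hbdd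
  have hsq : ∫ p, ∫ r, F p r ∂unitVolume ∂(unitVolume.prod unitVolume) =
      ∫ r, (∫ t, φ t * periodicExp u t r ∂unitVolume) ^ 2 ∂unitVolume := by
    rw [integral_integral_swap hFi]
    congr 1 with r
    rw [sq]
    exact integral_prod_mul (fun t => φ t * periodicExp u t r) (fun t => φ t * periodicExp u t r)
  have hF : ∀ᵐ p ∂(unitVolume.prod unitVolume), φ p.1 * φ p.2 *
      (exp (u * (1 - |p.1 - p.2|)) + exp (u * |p.1 - p.2|) - 2) =
      c⁻¹ * (∫ r, F p r ∂unitVolume) - 2 * (φ p.1 * φ p.2) := by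
    filter_upwards [ae_mem_unitSquare] with p hp
    have : ∫ r, F p r ∂unitVolume = φ p.1 * φ p.2 *
        (c * (exp (u * (1 - |p.1 - p.2|)) + exp (u * |p.1 - p.2|))) := by
      rw [← integral_periodicExp_mul hu hp.1 hp.2, ← integral_const_mul]
      congr 1 with r
      ring
    rw [this]
    field_simp
  have hφi : Integrable φ unitVolume :=
    integrable_unitVolume_of_abs_le hmeas fun x _ => hbdd x
  have hFp : Integrable (fun p => ∫ r, F p r ∂unitVolume) (unitVolume.prod unitVolume) :=
    hFi.integral_prod_left
  rw [integral_congr_ae hF, integral_sub (hFp.const_mul _)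
    ((hφi.mul_prod hφi).const_mul _), integral_const_mul, integral_const_mul,
    integral_prod_mul, hzero, hsq]
  have := integral_sq_integral_mul_periodicExp_pos hmeas hbdd hne hu
  simp only [mul_zero, sub_zero]
  positivity

lemma kernel_nonneg {u x : ℝ} (hx : x ∈ Set.Icc (0:ℝ) 1) (hu : 0 < u) :
    0 ≤ exp (u * (1 - x)) + exp (u * x) - 2 := by
  have h1 : 1 ≤ exp (u * (1 - x)) := one_le_exp (by nlinarith [hx.2])
  have h2 : 1 ≤ exp (u * x) := one_le_exp (by nlinarith [hx.1])
  linarith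

lemma kernel_div_le {u x : ℝ} (hx : x ∈ Set.Icc (0:ℝ) 1) (hu : 0 < u) :
    (exp (u * (1 - x)) + exp (u * x) - 2) / (exp u - 1) ≤
      exp (-(x * u)) + exp (-((1 - x) * u)) := by
  have h0 : 0 < exp u - 1 := sub_pos.2 (one_lt_exp_iff.2 hu)
  have h1 : exp (-(x * u)) ≤ 1 := exp_le_one_iff.2 (by nlinarith [hx.1])
  have h2 : exp (-((1 - x) * u)) ≤ 1 := exp_le_one_iff.2 (by nlinarith [hx.2])
  have h3 : exp (-(x * u)) * exp u = exp (u * (1 - x)) := by rw [← exp_add]; ring_nf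
  have h4 : exp (-((1 - x) * u)) * exp u = exp (u * x) := by rw [← exp_add]; ring_nf
  rw [div_le_iff₀ h0]
  linarith

lemma integrable_rpow_mul_exp_neg_mul_prod {α : Type*} [MeasurableSpace α] {μ : Measure α}
    [SFinite μ] {a : ℝ} (ha : 0 < a) {h : α → ℝ} (hm : Measurable h)
    (hpos : ∀ᵐ p ∂μ, 0 < h p) (hint : Integrable (fun p => (1 / h p) ^ a) μ) :
    Integrable (fun q : α × ℝ => q.2 ^ (a - 1) * exp (-(h q.1 * q.2)))
      (μ.prod (volume.restrict (Set.Ioi 0))) := by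
  have hmeas : Measurable fun q : α × ℝ => q.2 ^ (a - 1) * exp (-(h q.1 * q.2)) := by fun_prop
  rw [integrable_prod_iff hmeas.aestronglyMeasurable]
  constructor
  · filter_upwards [hpos] with p hp
    have := integrableOn_rpow_mul_exp_neg_mul_rpow (s := a - 1) (by linarith) one_pos hp
    simpa [IntegrableOn] using this
  · refine (hint.mul_const (Gamma a)).congr ?_
    filter_upwards [hpos] with p hp
    rw [← integral_rpow_mul_exp_neg_mul_Ioi ha hp]
    refine setIntegral_congr_fun measurableSet_Ioi fun u hu => ?_
    have : 0 < u := hu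
    rw [norm_of_nonneg (by positivity)]

lemma intervalIntegrable_one_div_rpow {a : ℝ} (ha : a < 1) :
    IntervalIntegrable (fun x : ℝ => (1 / x) ^ a) volume 0 1 := by
  refine (intervalIntegral.intervalIntegrable_rpow' (r := -a) (by linarith)).congr fun x hx => ?_
  rw [Set.uIoc_of_le zero_le_one] at hx
  simp only [one_div, inv_rpow hx.1.le, rpow_neg hx.1.le]

lemma ae_abs_sub_pos : ∀ᵐ p ∂(unitVolume.prod unitVolume), 0 < |p.1 - p.2| := by
  rw [Measure.ae_prod_iff_ae_ae (measurableSet_lt (by fun_prop) (by fun_prop))]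
  refine ae_of_all _ fun t => ?_
  filter_upwards [compl_mem_ae_iff.2 (measure_singleton t)] with s hs
  exact abs_pos.2 (sub_ne_zero.2 (Ne.symm hs))

lemma integrable_bound {a : ℝ} (ha : a ∈ Set.Ioo (0:ℝ) 1) :
    Integrable (fun q : (ℝ × ℝ) × ℝ => q.2 ^ (a - 1) * exp (-(|q.1.1 - q.1.2| * q.2)) +
        q.2 ^ (a - 1) * exp (-((1 - |q.1.1 - q.1.2|) * q.2)))
      ((unitVolume.prod unitVolume).prod (volume.restrict (Set.Ioi 0))) := by
  have hi := intervalIntegrable_one_div_rpow ha.2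
  have hi' : IntervalIntegrable (fun x : ℝ => (1 / (1 - x)) ^ a) volume 0 1 := by
    simpa using (hi.comp_sub_left 1 (by simp)).symm
  refine Integrable.add
    (integrable_rpow_mul_exp_neg_mul_prod (h := fun p : ℝ × ℝ => |p.1 - p.2|) ha.1 (by fun_prop)
      ae_abs_sub_pos (integrable_comp_abs_sub hi))
    (integrable_rpow_mul_exp_neg_mul_prod (h := fun p : ℝ × ℝ => 1 - |p.1 - p.2|) ha.1
      (by fun_prop) ?_ (integrable_comp_abs_sub hi'))
  filter_upwards [ae_mem_unitSquare] with p hp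
  obtain ⟨⟨h1, h2⟩, h3, h4⟩ := hp
  have : |p.1 - p.2| < 1 := abs_lt.2 ⟨by linarith, by linarith⟩
  linarith

lemma integrable_integrand {a : ℝ} (ha : a ∈ Set.Ioo (0:ℝ) 1) {φ : ℝ → ℝ} (hmeas : Measurable φ)
    {M : ℝ} (hbdd : ∀ x, |φ x| ≤ M) :
    Integrable (fun q : (ℝ × ℝ) × ℝ => φ q.1.1 * φ q.1.2 * (q.2 ^ (a - 1) / (exp q.2 - 1) *
        (exp (q.2 * (1 - |q.1.1 - q.1.2|)) + exp (q.2 * |q.1.1 - q.1.2|) - 2)))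
      ((unitVolume.prod unitVolume).prod (volume.restrict (Set.Ioi 0))) := by
  have hM : 0 ≤ M := (abs_nonneg _).trans (hbdd 0)
  refine ((integrable_bound ha).const_mul (M * M)).mono' (by fun_prop) ?_
  have hS : MeasurableSet ((Set.Ioc (0:ℝ) 1 ×ˢ Set.Ioc (0:ℝ) 1) ×ˢ Set.Ioi (0:ℝ)) :=
    (measurableSet_Ioc.prod measurableSet_Ioc).prod measurableSet_Ioi
  rw [Measure.prod_restrict, Measure.prod_restrict]
  filter_upwards [ae_restrict_mem hS] with q hq
  obtain ⟨⟨⟨h1, h2⟩, h3, h4⟩, hu⟩ := hq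
  replace hu : 0 < q.2 := hu
  have hx : |q.1.1 - q.1.2| ∈ Set.Icc (0:ℝ) 1 :=
    ⟨abs_nonneg _, abs_le.2 ⟨by linarith, by linarith⟩⟩
  have h0 : 0 < exp q.2 - 1 := sub_pos.2 (one_lt_exp_iff.2 hu)
  have hk := kernel_nonneg hx hu
  have hkb := kernel_div_le hx hu
  rw [norm_mul, norm_mul, Real.norm_eq_abs, Real.norm_eq_abs,
    norm_of_nonneg (mul_nonneg (by positivity) hk), div_mul_eq_mul_div, mul_div_assoc, ← mul_add]
  gcongr <;> apply hbdd

theorem variance_integral_positive (H : ℝ) (hH : H ∈ Set.Ioo (1/2 : ℝ) 1)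
    (φ : ℝ → ℝ) (hmeas : Measurable φ) (M : ℝ) (hbdd : ∀ x, |φ x| ≤ M)
    (hper : ∀ x, φ (x + 1) = φ x)
    (hzero : (∫ t in (0:ℝ)..1, φ t) = 0)
    (hne : ¬ (∀ᵐ x ∂(volume.restrict (Set.Icc (0:ℝ) 1)), φ x = 0)) :
    0 < (1 / Real.Gamma (2 - 2 * H)) *
        ∫ t in (0:ℝ)..1, ∫ s in (0:ℝ)..1, φ t * φ s *
          ∫ u in Set.Ioi (0:ℝ), u ^ (1 - 2 * H) / (Real.exp u - 1) *
            (Real.exp (u * (1 - |t - s|)) + Real.exp (u * |t - s|) - 2) := by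
  obtain ⟨hH1, hH2⟩ := hH
  have ha : 2 - 2 * H ∈ Set.Ioo (0:ℝ) 1 := ⟨by linarith, by linarith⟩
  have hI := integrable_integrand ha hmeas hbdd
  rw [show 2 - 2 * H - 1 = 1 - 2 * H by ring] at hI
  refine mul_pos (one_div_pos.2 (Gamma_pos_of_pos ha.1)) ?_
  simp only [intervalIntegral.integral_of_le (zero_le_one' ℝ)] at hzero ⊢
  simp only [← integral_const_mul]
  have hI' := hI.integral_prod_left
  rw [← integral_prod _ hI', integral_integral_swap hI]
  set P : ℝ → ℝ := fun u => ∫ p : ℝ × ℝ, φ p.1 * φ p.2 * (u ^ (1 - 2 * H) / (exp u - 1) *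
    (exp (u * (1 - |p.1 - p.2|)) + exp (u * |p.1 - p.2|) - 2)) ∂(unitVolume.prod unitVolume)
  have hP : ∀ u ∈ Set.Ioi (0:ℝ), 0 < P u := fun u (hu : 0 < u) => by
    have h0 : 0 < exp u - 1 := sub_pos.2 (one_lt_exp_iff.2 hu)
    simp only [P, mul_left_comm (φ _ * φ _)]
    rw [integral_const_mul]
    exact mul_pos (by positivity) (integral_mul_kernel_pos hmeas hbdd hzero hne hu)
  have hPi : IntegrableOn P (Set.Ioi 0) := hI.integral_prod_right
  change 0 < ∫ u in Set.Ioi (0:ℝ), P u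
  rw [setIntegral_pos_iff_support_of_nonneg_ae
    ((ae_restrict_iff' measurableSet_Ioi).2 (ae_of_all _ fun u hu => (hP u hu).le)) hPi,
    Set.inter_eq_right.2 fun u hu => Function.mem_support.2 (hP u hu).ne']
  simp
end

section
/- Let H ∈ (1/2, 1) and let φ : ℝ → ℝ be a bounded measurable 1-periodic function with ∫₀¹ φ(t) dt = 0, and let c_n, n ∈ ℤ \ {0}, be its Fourier coefficients with respect to the real orthonormal system f_n on [0,1] (so c_n = ∫₀¹ φ(x) f_n(x) dx). Then (1/Γ(2−2H)) ∫₀¹ ∫₀¹ φ(t) φ(s) ∫₀^∞ (u^{1−2H}/(e^u − 1)) · (e^{u(1−|t−s|)} + e^{u|t−s|} − 2) du dt ds = (2/Γ(2−2H)) · Σ_{n∈ℤ\{0}} c_n² · ∫₀^∞ u^{2−2H} / ((2π|n|)² + u²) du. -/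
open Real MeasureTheory

/-- The Fourier weight `2u / (u² + (2πn)²)` of the symmetrised exponential on the circle. -/
noncomputable def lorentzWeight (u : ℝ) (n : ℤ) : ℝ := 2 * u / (u ^ 2 + (2 * π * n) ^ 2)

lemma lorentzWeight_nonneg {u : ℝ} (hu : 0 < u) (n : ℤ) : 0 ≤ lorentzWeight u n := by
  unfold lorentzWeight; positivity

lemma summable_lorentzWeight {u : ℝ} (hu : 0 < u) : Summable (lorentzWeight u) := by
  have h1 : Summable fun n : ℤ => 2 * u / (2 * π) ^ 2 * (1 / (n : ℝ) ^ 2) :=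
    (Real.summable_one_div_int_pow.mpr one_lt_two).mul_left _
  have h2 : Summable fun n : ℤ => if n = 0 then 2 / u else 0 :=
    summable_of_hasFiniteSupport ((Set.finite_singleton (0 : ℤ)).subset fun n hn => by
      by_contra h; exact hn (if_neg h))
  refine (h1.add h2).of_nonneg_of_le (lorentzWeight_nonneg hu) fun n => ?_
  unfold lorentzWeight
  rcases eq_or_ne n 0 with rfl | hn
  · simp; apply le_of_eq; field_simp
  · have hn' : (n : ℝ) ≠ 0 := by exact_mod_cast hn
    simp only [hn, if_false, add_zero]
    rw [div_mul_div_comm, mul_one, ← mul_pow]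
    gcongr
    nlinarith [sq_nonneg u]

lemma fourierCoeffOn_exp_add_exp {u : ℝ} (hu : 0 < u) (n : ℤ) :
    fourierCoeffOn (zero_lt_one' ℝ)
      (fun x : ℝ => ((Real.exp (u * (1 - x)) + Real.exp (u * x) : ℝ) : ℂ)) n =
      (((Real.exp u - 1) * lorentzWeight u n : ℝ) : ℂ) := by
  have hre1 : (u - 2 * π * n * Complex.I : ℂ) ≠ 0 := fun h => by
    have := congrArg Complex.re h; simp at this; exact hu.ne' this
  have hre2 : (-u - 2 * π * n * Complex.I : ℂ) ≠ 0 := fun h => by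
    have := congrArg Complex.re h; simp at this; exact hu.ne' this
  have hper : Complex.exp (2 * π * n * Complex.I) = 1 := by
    rw [show (2 * π * n * Complex.I : ℂ) = n * (2 * π * Complex.I) by ring]
    exact Complex.exp_int_mul_two_pi_mul_I n
  have hsplit : ∀ x : ℝ, fourier (-n) (x : AddCircle (1 - 0 : ℝ)) •
      ((Real.exp (u * (1 - x)) + Real.exp (u * x) : ℝ) : ℂ) =
      Complex.exp u * Complex.exp ((-u - 2 * π * n * Complex.I) * x) +
        Complex.exp ((u - 2 * π * n * Complex.I) * x) := fun x => by
    rw [fourier_coe_apply, smul_eq_mul]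
    push_cast
    rw [mul_add, ← Complex.exp_add, ← Complex.exp_add, ← Complex.exp_add]
    congr 2 <;> simp <;> ring
  rw [fourierCoeffOn_eq_integral]
  simp_rw [hsplit]
  rw [intervalIntegral.integral_add (Continuous.intervalIntegrable (by fun_prop) _ _)
    (Continuous.intervalIntegrable (by fun_prop) _ _), intervalIntegral.integral_const_mul,
    integral_exp_mul_complex hre1, integral_exp_mul_complex hre2]
  simp only [Complex.ofReal_one, mul_one, Complex.ofReal_zero, mul_zero, Complex.exp_zero,
    sub_zero, div_one, one_smul, Complex.exp_sub, hper, Complex.exp_neg]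
  have hden : ((u : ℂ) ^ 2 + (2 * π * n) ^ 2) ≠ 0 := by
    have : (u ^ 2 + (2 * π * n) ^ 2 : ℝ) ≠ 0 := by positivity
    exact_mod_cast this
  have hfac : ((u : ℂ) ^ 2 + (2 * π * n) ^ 2) =
      -((u - 2 * π * n * Complex.I) * (-u - 2 * π * n * Complex.I)) := by
    linear_combination (2 * π * n : ℂ) ^ 2 * (Complex.I_sq)
  unfold lorentzWeight
  push_cast
  rw [hfac]
  have := Complex.exp_ne_zero u
  field_simp
  ring

/-- Fourier expansion on `[0,1]` of the symmetrised exponential. -/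
lemma hasSum_lorentzWeight_mul_cos {u : ℝ} (hu : 0 < u) {x : ℝ} (hx : x ∈ Set.Icc (0 : ℝ) 1) :
    HasSum (fun n : ℤ => lorentzWeight u n * Real.cos (2 * π * n * x))
      ((Real.exp (u * (1 - x)) + Real.exp (u * x)) / (Real.exp u - 1)) := by
  have he : 0 < Real.exp u - 1 := by simpa using hu
  suffices h : ∀ x ∈ Set.Ico (0 : ℝ) 1,
      HasSum (fun n : ℤ => lorentzWeight u n * Real.cos (2 * π * n * x))
      ((Real.exp (u * (1 - x)) + Real.exp (u * x)) / (Real.exp u - 1)) by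
    rcases hx.2.lt_or_eq with h1 | rfl
    · exact h x ⟨hx.1, h1⟩
    · convert! h 0 (by simp) using 2 with n
      · congr 1
        rw [mul_one, mul_zero, Real.cos_zero, mul_comm]
        exact Real.cos_int_mul_two_pi n
      · simp [add_comm]
  intro x hx
  set g : ℝ → ℂ := fun x => ((Real.exp (u * (1 - x)) + Real.exp (u * x) : ℝ) : ℂ) with hg
  have : Fact ((0 : ℝ) < 1) := ⟨zero_lt_one⟩
  have hcont : Continuous (AddCircle.liftIco (1 : ℝ) 0 g) :=
    AddCircle.liftIco_zero_continuous (by simp [hg, add_comm]) (by fun_prop)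
  have hcoeff : ∀ n : ℤ, fourierCoeff (AddCircle.liftIco (1 : ℝ) 0 g) n =
      (((Real.exp u - 1) * lorentzWeight u n : ℝ) : ℂ) := fun n => by
    rw [fourierCoeff_liftIco_eq, ← fourierCoeffOn_exp_add_exp hu n]
    congr 1
    simp
  have hsum : Summable (fourierCoeff (⟨_, hcont⟩ : C(AddCircle (1 : ℝ), ℂ))) := by
    refine Summable.congr (f := fun n : ℤ => (((Real.exp u - 1) * lorentzWeight u n : ℝ) : ℂ)) ?_
      fun n => (hcoeff n).symm
    exact Complex.ofRealCLM.summable ((summable_lorentzWeight hu).mul_left _)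
  have key := has_pointwise_sum_fourier_series_of_summable hsum (x : AddCircle (1 : ℝ))
  rw [ContinuousMap.coe_mk, AddCircle.liftIco_coe_apply (by simpa using hx)] at key
  have key2 := (Complex.reCLM.hasSum key).mul_left (Real.exp u - 1)⁻¹
  convert! key2 using 1
  · ext n
    have h3 : (fourier n (x : AddCircle (1 : ℝ)) : ℂ) =
        Complex.exp (((2 * π * n * x : ℝ) : ℂ) * Complex.I) := by
      rw [fourier_coe_apply]; congr 1; push_cast; ring
    simp only [hcoeff, h3, smul_eq_mul, Complex.reCLM_apply,
      Complex.re_ofReal_mul, Complex.exp_ofReal_mul_I_re]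
    field_simp
  · simp only [hg, Complex.reCLM_apply, Complex.ofReal_re]
    rw [div_eq_inv_mul]

instance isProbabilityMeasure_unitVolume : IsProbabilityMeasure unitVolume :=
  ⟨by simp⟩

lemma ae_abs_sub_mem_Icc :
    ∀ᵐ p : ℝ × ℝ ∂(unitVolume.prod unitVolume), |p.1 - p.2| ∈ Set.Icc (0 : ℝ) 1 := by
  rw [Measure.prod_restrict]
  filter_upwards [ae_restrict_mem (measurableSet_Ioc.prod measurableSet_Ioc)] with p hp
  obtain ⟨⟨h1, h2⟩, h3, h4⟩ := hp
  exact ⟨abs_nonneg _, abs_le.mpr ⟨by linarith, by linarith⟩⟩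

lemma integral_prod_mul_cos_sub {φ : ℝ → ℝ} (hmeas : Measurable φ) {M : ℝ}
    (hbdd : ∀ x, |φ x| ≤ M) (a : ℝ) :
    ∫ p : ℝ × ℝ, φ p.1 * φ p.2 * Real.cos (a * |p.1 - p.2|) ∂(unitVolume.prod unitVolume) =
      (∫ x, φ x * Real.cos (a * x) ∂unitVolume) ^ 2 +
        (∫ x, φ x * Real.sin (a * x) ∂unitVolume) ^ 2 := by
  have hc : Integrable (fun x => φ x * Real.cos (a * x)) unitVolume :=
    Integrable.of_bound (by fun_prop) M (ae_of_all _ fun x => by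
      rw [Real.norm_eq_abs, abs_mul]
      exact (mul_le_of_le_one_right (abs_nonneg _) (Real.abs_cos_le_one _)).trans (hbdd x))
  have hs : Integrable (fun x => φ x * Real.sin (a * x)) unitVolume :=
    Integrable.of_bound (by fun_prop) M (ae_of_all _ fun x => by
      rw [Real.norm_eq_abs, abs_mul]
      exact (mul_le_of_le_one_right (abs_nonneg _) (Real.abs_sin_le_one _)).trans (hbdd x))
  have hsplit : ∀ p : ℝ × ℝ, φ p.1 * φ p.2 * Real.cos (a * |p.1 - p.2|) =
      φ p.1 * Real.cos (a * p.1) * (φ p.2 * Real.cos (a * p.2)) +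
        φ p.1 * Real.sin (a * p.1) * (φ p.2 * Real.sin (a * p.2)) := fun p => by
    have : Real.cos (a * |p.1 - p.2|) = Real.cos (a * p.1 - a * p.2) := by
      rw [← mul_sub]
      rcases abs_choice (p.1 - p.2) with h | h <;> rw [h]
      rw [mul_neg, Real.cos_neg]
    rw [this, Real.cos_sub]; ring
  simp_rw [hsplit]
  rw [integral_add (hc.mul_prod hc) (hs.mul_prod hs),
    integral_prod_mul (fun x => φ x * Real.cos (a * x)) (fun x => φ x * Real.cos (a * x)),
    integral_prod_mul (fun x => φ x * Real.sin (a * x)) (fun x => φ x * Real.sin (a * x))]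
  ring

lemma abs_mul_mul_le {φ : ℝ → ℝ} {M : ℝ} (hbdd : ∀ x, |φ x| ≤ M) (s t : ℝ) :
    |φ s * φ t| ≤ M ^ 2 := by
  rw [abs_mul, sq]
  exact mul_le_mul (hbdd s) (hbdd t) (abs_nonneg _) ((abs_nonneg _).trans (hbdd s))

/-- The symmetrised exponential kernel on the circle of length one. -/
noncomputable def expKernel (u x : ℝ) : ℝ :=
  (Real.exp (u * (1 - x)) + Real.exp (u * x) - 2) / (Real.exp u - 1)

lemma expKernel_nonneg {u x : ℝ} (hu : 0 < u) (hx : x ∈ Set.Icc (0 : ℝ) 1) :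
    0 ≤ expKernel u x := by
  have h1 := Real.one_le_exp (mul_nonneg hu.le hx.1)
  have h2 := Real.one_le_exp (mul_nonneg hu.le (sub_nonneg.mpr hx.2))
  have h3 := Real.one_le_exp hu.le
  exact div_nonneg (by linarith) (by linarith)

lemma expKernel_le_one {u x : ℝ} (hu : 0 < u) (hx : x ∈ Set.Icc (0 : ℝ) 1) :
    expKernel u x ≤ 1 := by
  have h1 := Real.one_le_exp (mul_nonneg hu.le hx.1)
  have h2 := Real.one_le_exp (mul_nonneg hu.le (sub_nonneg.mpr hx.2))
  have h3 : 0 < Real.exp u - 1 := by simpa using hu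
  have h4 : Real.exp u = Real.exp (u * (1 - x)) * Real.exp (u * x) := by
    rw [← Real.exp_add]; ring_nf
  rw [expKernel, div_le_one h3]
  nlinarith

lemma measurable_expKernel : Measurable fun q : ℝ × ℝ => expKernel q.1 q.2 := by
  unfold expKernel; fun_prop

/-- Fourier diagonalisation of the quadratic form of the kernel, up to the zero mode. -/
lemma hasSum_integral_expKernel {φ : ℝ → ℝ} (hmeas : Measurable φ) {M : ℝ}
    (hbdd : ∀ x, |φ x| ≤ M) {u : ℝ} (hu : 0 < u) :
    HasSum (fun n : ℤ => lorentzWeight u n *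
        ((∫ x, φ x * Real.cos (2 * π * n * x) ∂unitVolume) ^ 2 +
          (∫ x, φ x * Real.sin (2 * π * n * x) ∂unitVolume) ^ 2))
      ((∫ p : ℝ × ℝ, φ p.1 * φ p.2 * expKernel u |p.1 - p.2| ∂(unitVolume.prod unitVolume)) +
        2 / (Real.exp u - 1) * (∫ x, φ x ∂unitVolume) ^ 2) := by
  have hφφ : Integrable (fun p : ℝ × ℝ => φ p.1 * φ p.2) (unitVolume.prod unitVolume) :=
    Integrable.of_bound (by fun_prop) (M ^ 2) (ae_of_all _ fun p => abs_mul_mul_le hbdd _ _)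
  have hK : Integrable (fun p : ℝ × ℝ => φ p.1 * φ p.2 * expKernel u |p.1 - p.2|)
      (unitVolume.prod unitVolume) := by
    refine Integrable.of_bound (by
      have := measurable_expKernel
      exact (Measurable.mul (by fun_prop) (this.comp
        (g := fun q : ℝ × ℝ => expKernel q.1 q.2) (f := fun p : ℝ × ℝ => (u, |p.1 - p.2|))
        (by fun_prop))).aestronglyMeasurable) (M ^ 2) ?_
    filter_upwards [ae_abs_sub_mem_Icc] with p hp
    rw [Real.norm_eq_abs, abs_mul, abs_of_nonneg (expKernel_nonneg hu hp)]
    exact (mul_le_of_le_one_right (abs_nonneg _) (expKernel_le_one hu hp)).trans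
      (abs_mul_mul_le hbdd _ _)
  have hval : (∫ p : ℝ × ℝ, φ p.1 * φ p.2 * expKernel u |p.1 - p.2|
        ∂(unitVolume.prod unitVolume)) + 2 / (Real.exp u - 1) * (∫ x, φ x ∂unitVolume) ^ 2 =
      ∫ p : ℝ × ℝ, φ p.1 * φ p.2 * ((Real.exp (u * (1 - |p.1 - p.2|)) +
        Real.exp (u * |p.1 - p.2|)) / (Real.exp u - 1)) ∂(unitVolume.prod unitVolume) := by
    rw [sq, ← integral_prod_mul, ← integral_const_mul, ← integral_add hK (hφφ.const_mul _)]
    congr 1 with p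
    rw [expKernel]; ring
  rw [hval]
  simp_rw [← integral_prod_mul_cos_sub hmeas hbdd, ← integral_const_mul]
  refine hasSum_integral_of_dominated_convergence (fun n _ => lorentzWeight u n * M ^ 2)
    (fun n => by fun_prop) (fun n => ae_of_all _ fun p => ?_)
    (ae_of_all _ fun p => (summable_lorentzWeight hu).mul_right _) (integrable_const _) ?_
  · rw [Real.norm_eq_abs, abs_mul, abs_of_nonneg (lorentzWeight_nonneg hu n), abs_mul]
    gcongr
    · exact lorentzWeight_nonneg hu n
    · exact (mul_le_of_le_one_right (abs_nonneg _) (Real.abs_cos_le_one _)).trans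
        (abs_mul_mul_le hbdd _ _)
  · filter_upwards [ae_abs_sub_mem_Icc] with p hp
    convert! (hasSum_lorentzWeight_mul_cos hu hp).mul_left (φ p.1 * φ p.2) using 2
    ring

lemma integral_expKernel_le {u : ℝ} (hu : 0 < u) :
    ∫ p : ℝ × ℝ, expKernel u |p.1 - p.2| ∂(unitVolume.prod unitVolume) ≤ 2 / u := by
  have he : 0 < Real.exp u - 1 := by simpa using hu
  have h := hasSum_integral_expKernel (φ := fun _ => 1) measurable_const (M := 1) (by simp) hu
  have h0 : HasSum (fun n : ℤ => lorentzWeight u n *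
        ((∫ x, (1 : ℝ) * Real.cos (2 * π * n * x) ∂unitVolume) ^ 2 +
          (∫ x, (1 : ℝ) * Real.sin (2 * π * n * x) ∂unitVolume) ^ 2)) (2 / u) := by
    convert! hasSum_ite_eq (0 : ℤ) (2 / u) using 2 with n
    split_ifs with hn
    · subst hn
      simp [lorentzWeight]
      field_simp
    · have hn' : (n : ℝ) ≠ 0 := by exact_mod_cast hn
      have h2 : 2 * π * n ≠ 0 := by positivity
      have hcos : Real.cos (2 * π * n) = 1 := by
        rw [mul_comm]; exact Real.cos_int_mul_two_pi n
      have hsin : Real.sin (2 * π * n) = 0 := by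
        rw [show 2 * π * n = ((2 * n : ℤ) : ℝ) * π by push_cast; ring]
        exact Real.sin_int_mul_pi _
      simp_rw [one_mul]
      rw [← intervalIntegral.integral_of_le zero_le_one,
        ← intervalIntegral.integral_of_le zero_le_one,
        intervalIntegral.integral_comp_mul_left (fun x => Real.cos x) h2,
        intervalIntegral.integral_comp_mul_left (fun x => Real.sin x) h2, integral_cos,
        integral_sin]
      simp [hcos, hsin]
  have := h.unique h0
  simp only [one_mul] at this
  rw [← this]
  exact le_add_of_nonneg_right (by positivity)

/-- The function over which Fubini's theorem is applied is integrable. -/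
lemma integrable_rpow_mul_expKernel {H : ℝ} (hH : H ∈ Set.Ioo (1 / 2 : ℝ) 1) {φ : ℝ → ℝ}
    (hmeas : Measurable φ) {M : ℝ} (hbdd : ∀ x, |φ x| ≤ M) :
    Integrable (fun q : (ℝ × ℝ) × ℝ => φ q.1.1 * φ q.1.2 *
        (q.2 ^ (1 - 2 * H) * expKernel q.2 |q.1.1 - q.1.2|))
      ((unitVolume.prod unitVolume).prod (volume.restrict (Set.Ioi 0))) := by
  have hKm : Measurable fun q : (ℝ × ℝ) × ℝ => expKernel q.2 |q.1.1 - q.1.2| :=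
    measurable_expKernel.comp (f := fun q : (ℝ × ℝ) × ℝ => (q.2, |q.1.1 - q.1.2|)) (by fun_prop)
  have hFm : Measurable fun q : (ℝ × ℝ) × ℝ => φ q.1.1 * φ q.1.2 *
      (q.2 ^ (1 - 2 * H) * expKernel q.2 |q.1.1 - q.1.2|) := by
    exact Measurable.mul (by fun_prop) (Measurable.mul (by fun_prop) hKm)
  have hbound : ∀ u : ℝ, 0 < u → ∀ᵐ p : ℝ × ℝ ∂(unitVolume.prod unitVolume),
      ‖φ p.1 * φ p.2 * (u ^ (1 - 2 * H) * expKernel u |p.1 - p.2|)‖ ≤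
        M ^ 2 * u ^ (1 - 2 * H) * expKernel u |p.1 - p.2| := fun u hu => by
    filter_upwards [ae_abs_sub_mem_Icc] with p hp
    have hk := expKernel_nonneg hu hp
    have hr : 0 ≤ u ^ (1 - 2 * H) := by positivity
    rw [Real.norm_eq_abs, abs_mul, abs_of_nonneg (mul_nonneg hr hk), mul_assoc]
    exact mul_le_mul_of_nonneg_right (abs_mul_mul_le hbdd _ _) (mul_nonneg hr hk)
  have hKi : ∀ u : ℝ, 0 < u → Integrable (fun p : ℝ × ℝ => expKernel u |p.1 - p.2|)
      (unitVolume.prod unitVolume) := fun u hu => by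
    refine Integrable.of_bound
      (hKm.comp (f := fun p : ℝ × ℝ => (p, u)) (by fun_prop)).aestronglyMeasurable 1 ?_
    filter_upwards [ae_abs_sub_mem_Icc] with p hp
    rw [Real.norm_eq_abs, abs_of_nonneg (expKernel_nonneg hu hp)]
    exact expKernel_le_one hu hp
  have hsec : ∀ u : ℝ, 0 < u → Integrable (fun p : ℝ × ℝ => φ p.1 * φ p.2 *
      (u ^ (1 - 2 * H) * expKernel u |p.1 - p.2|)) (unitVolume.prod unitVolume) := fun u hu =>
    ((hKi u hu).const_mul (M ^ 2 * u ^ (1 - 2 * H))).mono'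
      (hFm.comp (f := fun p : ℝ × ℝ => (p, u)) (by fun_prop)).aestronglyMeasurable (hbound u hu)
  have hle : ∀ u : ℝ, 0 < u → ∫ p : ℝ × ℝ, ‖φ p.1 * φ p.2 *
      (u ^ (1 - 2 * H) * expKernel u |p.1 - p.2|)‖ ∂(unitVolume.prod unitVolume) ≤
        M ^ 2 * u ^ (1 - 2 * H) *
          ∫ p : ℝ × ℝ, expKernel u |p.1 - p.2| ∂(unitVolume.prod unitVolume) := fun u hu => by
    rw [← integral_const_mul]
    exact integral_mono_ae (hsec u hu).norm ((hKi u hu).const_mul _) (hbound u hu)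
  have hle_one : ∀ u : ℝ, 0 < u →
      ∫ p : ℝ × ℝ, expKernel u |p.1 - p.2| ∂(unitVolume.prod unitVolume) ≤ 1 := fun u hu => by
    refine (integral_mono_ae (hKi u hu) (integrable_const 1) ?_).trans (by simp)
    filter_upwards [ae_abs_sub_mem_Icc] with p hp using expKernel_le_one hu hp
  rw [integrable_prod_iff' hFm.aestronglyMeasurable]
  refine ⟨(ae_restrict_mem measurableSet_Ioi).mono hsec, ?_⟩
  have hnm : AEStronglyMeasurable (fun u : ℝ => ∫ p : ℝ × ℝ, ‖φ p.1 * φ p.2 *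
      (u ^ (1 - 2 * H) * expKernel u |p.1 - p.2|)‖ ∂(unitVolume.prod unitVolume)) volume :=
    (hFm.norm.stronglyMeasurable.integral_prod_left'
      (μ := unitVolume.prod unitVolume)).aestronglyMeasurable
  change IntegrableOn _ (Set.Ioi 0) volume
  rw [← Set.Ioc_union_Ioi_eq_Ioi zero_le_one]
  refine IntegrableOn.union ?_ ?_
  · have hi : IntegrableOn (fun u : ℝ => M ^ 2 * u ^ (1 - 2 * H)) (Set.Ioc 0 1) :=
      ((intervalIntegrable_iff_integrableOn_Ioc_of_le zero_le_one).mp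
        (intervalIntegral.intervalIntegrable_rpow' (by linarith [hH.2]))).const_mul _
    refine Integrable.mono' hi hnm.restrict ?_
    filter_upwards [ae_restrict_mem measurableSet_Ioc] with u hu
    rw [Real.norm_of_nonneg (integral_nonneg fun _ => norm_nonneg _)]
    have hu0 : 0 < u := hu.1
    exact (hle u hu0).trans (mul_le_of_le_one_right (by positivity) (hle_one u hu0))
  · have hi : IntegrableOn (fun u : ℝ => M ^ 2 * 2 * u ^ (-(2 * H))) (Set.Ioi 1) :=
      (integrableOn_Ioi_rpow_of_lt (by linarith [hH.1]) zero_lt_one).const_mul _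
    refine Integrable.mono' hi hnm.restrict ?_
    filter_upwards [ae_restrict_mem measurableSet_Ioi] with u hu
    rw [Real.norm_of_nonneg (integral_nonneg fun _ => norm_nonneg _)]
    have hu0 : 0 < u := zero_lt_one.trans hu
    refine (hle u hu0).trans ((mul_le_mul_of_nonneg_left (integral_expKernel_le hu0)
      (by positivity)).trans_eq ?_)
    rw [show 1 - 2 * H = -(2 * H) + 1 by ring, Real.rpow_add_one hu0.ne']
    field_simp

/-- Fourier series of the double integral, over all integers. -/
lemma hasSum_integral_rpow_expKernel {H : ℝ} (hH : H ∈ Set.Ioo (1 / 2 : ℝ) 1) {φ : ℝ → ℝ}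
    (hmeas : Measurable φ) {M : ℝ} (hbdd : ∀ x, |φ x| ≤ M)
    (hzero : ∫ x, φ x ∂unitVolume = 0) :
    HasSum (fun n : ℤ => 2 * ((∫ x, φ x * Real.cos (2 * π * n * x) ∂unitVolume) ^ 2 +
          (∫ x, φ x * Real.sin (2 * π * n * x) ∂unitVolume) ^ 2) *
        ∫ u in Set.Ioi (0 : ℝ), u ^ (2 - 2 * H) / ((2 * π * |(n : ℝ)|) ^ 2 + u ^ 2))
      (∫ t, ∫ s, φ t * φ s * (∫ u in Set.Ioi (0 : ℝ), u ^ (1 - 2 * H) * expKernel u |t - s|)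
        ∂unitVolume ∂unitVolume) := by
  have hF := integrable_rpow_mul_expKernel hH hmeas hbdd
  set A : ℤ → ℝ := fun n => (∫ x, φ x * Real.cos (2 * π * n * x) ∂unitVolume) ^ 2 +
    (∫ x, φ x * Real.sin (2 * π * n * x) ∂unitVolume) ^ 2 with hA
  have hA0 : ∀ n, 0 ≤ A n := fun n => by simp only [hA]; positivity
  have hL : (∫ t, ∫ s, φ t * φ s * (∫ u in Set.Ioi (0 : ℝ), u ^ (1 - 2 * H) *
      expKernel u |t - s|) ∂unitVolume ∂unitVolume) = ∫ u in Set.Ioi (0 : ℝ), ∫ p : ℝ × ℝ,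
        φ p.1 * φ p.2 * (u ^ (1 - 2 * H) * expKernel u |p.1 - p.2|)
          ∂(unitVolume.prod unitVolume) := by
    have h1 := hF.integral_prod_left
    rw [← integral_integral_swap (f := fun (p : ℝ × ℝ) (u : ℝ) => φ p.1 * φ p.2 *
      (u ^ (1 - 2 * H) * expKernel u |p.1 - p.2|)) hF, integral_prod _ h1]
    simp_rw [integral_const_mul]
  have hS : ∀ u : ℝ, 0 < u → HasSum (fun n : ℤ => u ^ (1 - 2 * H) * (lorentzWeight u n * A n))
      (∫ p : ℝ × ℝ, φ p.1 * φ p.2 * (u ^ (1 - 2 * H) * expKernel u |p.1 - p.2|)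
          ∂(unitVolume.prod unitVolume)) := fun u hu => by
    have h := (hasSum_integral_expKernel hmeas hbdd hu).mul_left (u ^ (1 - 2 * H))
    rw [hzero, zero_pow two_ne_zero, mul_zero, add_zero, ← integral_const_mul] at h
    convert! h using 1
    refine integral_congr_ae (ae_of_all _ fun p => ?_)
    dsimp only
    ring
  have hmw : ∀ n : ℤ, Measurable fun u : ℝ => u ^ (1 - 2 * H) * (lorentzWeight u n * A n) :=
    fun n => by unfold lorentzWeight; fun_prop
  rw [hL]
  have key := hasSum_integral_of_dominated_convergence (μ := volume.restrict (Set.Ioi (0 : ℝ)))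
    (F := fun (n : ℤ) (u : ℝ) => u ^ (1 - 2 * H) * (lorentzWeight u n * A n))
    (fun n u => u ^ (1 - 2 * H) * (lorentzWeight u n * A n))
    (fun n => (hmw n).aestronglyMeasurable)
    (fun n => by
      filter_upwards [ae_restrict_mem measurableSet_Ioi] with u hu
      exact (Real.norm_of_nonneg (mul_nonneg (Real.rpow_nonneg (le_of_lt hu) _)
        (mul_nonneg (lorentzWeight_nonneg hu n) (hA0 n)))).le)
    (by
      filter_upwards [ae_restrict_mem measurableSet_Ioi] with u hu using (hS u hu).summable)
    (hF.integral_prod_right.congr (by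
      filter_upwards [ae_restrict_mem measurableSet_Ioi] with u hu
      exact (hS u hu).tsum_eq.symm))
    (by filter_upwards [ae_restrict_mem measurableSet_Ioi] with u hu using hS u hu)
  convert! key using 2 with n
  rw [← integral_const_mul]
  refine setIntegral_congr_fun measurableSet_Ioi fun u hu => ?_
  have hu0 : (0 : ℝ) < u := hu
  have hr : u ^ (2 - 2 * H) = u ^ (1 - 2 * H) * u := by
    rw [← Real.rpow_add_one hu0.ne']; ring_nf
  simp only [lorentzWeight, hr, mul_pow, sq_abs]
  rw [add_comm (u ^ 2)]
  ring

lemma fourierBasisFun_coeff_sq_add_neg {φ : ℝ → ℝ} {c : ℤ → ℝ}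
    (hc : ∀ n : ℤ, n ≠ 0 → c n = ∫ x in (0:ℝ)..1, φ x * fourierBasisFun n x) {n : ℤ}
    (hn : n ≠ 0) :
    c n ^ 2 + c (-n) ^ 2 = 2 * ((∫ x, φ x * Real.cos (2 * π * n * x) ∂unitVolume) ^ 2 +
          (∫ x, φ x * Real.sin (2 * π * n * x) ∂unitVolume) ^ 2) := by
  have hpos : ∀ m : ℤ, 0 < m →
      c m = Real.sqrt 2 * ∫ x, φ x * Real.sin (2 * π * m * x) ∂unitVolume := fun m hm => by
    rw [hc m hm.ne', intervalIntegral.integral_of_le zero_le_one, ← integral_const_mul]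
    congr 1 with x
    rw [fourierBasisFun, if_pos hm]; ring
  have hneg : ∀ m : ℤ, 0 < m →
      c (-m) = Real.sqrt 2 * ∫ x, φ x * Real.cos (2 * π * m * x) ∂unitVolume := fun m hm => by
    rw [hc (-m) (by omega), intervalIntegral.integral_of_le zero_le_one, ← integral_const_mul]
    congr 1 with x
    have hm' : (0 : ℝ) < m := by exact_mod_cast hm
    rw [fourierBasisFun, if_neg (by omega), Int.cast_neg, abs_neg, abs_of_pos hm']; ring
  rcases hn.lt_or_gt with h | h
  · have h1 := hpos (-n) (by omega)
    have h2 := hneg (-n) (by omega)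
    rw [neg_neg] at h2
    rw [h1, h2]
    simp only [Int.cast_neg, mul_neg, neg_mul, Real.cos_neg, Real.sin_neg, integral_neg,
      mul_pow, neg_sq, Real.sq_sqrt zero_le_two]
    ring
  · rw [hpos n h, hneg n h]
    simp only [mul_pow, Real.sq_sqrt zero_le_two]
    ring

theorem variance_fourier_representation (H : ℝ) (hH : H ∈ Set.Ioo (1/2 : ℝ) 1)
    (φ : ℝ → ℝ) (hmeas : Measurable φ) (M : ℝ) (hbdd : ∀ x, |φ x| ≤ M)
    (hper : ∀ x, φ (x + 1) = φ x)
    (hzero : (∫ t in (0:ℝ)..1, φ t) = 0)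
    (c : ℤ → ℝ) (hc : ∀ n : ℤ, n ≠ 0 → c n = ∫ x in (0:ℝ)..1, φ x * fourierBasisFun n x) :
    (1 / Real.Gamma (2 - 2 * H)) *
        (∫ t in (0:ℝ)..1, ∫ s in (0:ℝ)..1, φ t * φ s *
          ∫ u in Set.Ioi (0:ℝ), u ^ (1 - 2 * H) / (Real.exp u - 1) *
            (Real.exp (u * (1 - |t - s|)) + Real.exp (u * |t - s|) - 2))
      = (2 / Real.Gamma (2 - 2 * H)) *
          ∑' n : {n : ℤ // n ≠ 0}, (c n) ^ 2 *
            ∫ u in Set.Ioi (0:ℝ), u ^ (2 - 2 * H) / ((2 * π * |((n : ℤ) : ℝ)|) ^ 2 + u ^ 2) := by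
  rw [intervalIntegral.integral_of_le zero_le_one] at hzero
  have hsum := hasSum_integral_rpow_expKernel hH hmeas hbdd hzero
  simp only [intervalIntegral.integral_of_le (zero_le_one' ℝ)]
  have hker : ∀ u x : ℝ, u ^ (1 - 2 * H) / (Real.exp u - 1) *
      (Real.exp (u * (1 - x)) + Real.exp (u * x) - 2) = u ^ (1 - 2 * H) * expKernel u x :=
    fun u x => by rw [expKernel]; ring
  simp only [hker]
  set L := ∫ t, ∫ s, φ t * φ s * (∫ u in Set.Ioi (0 : ℝ), u ^ (1 - 2 * H) *
    expKernel u |t - s|) ∂unitVolume ∂unitVolume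
  set I : ℤ → ℝ := fun n =>
    ∫ u in Set.Ioi (0 : ℝ), u ^ (2 - 2 * H) / ((2 * π * |(n : ℝ)|) ^ 2 + u ^ 2) with hI
  have hI0 : ∀ n, 0 ≤ I n := fun n => setIntegral_nonneg measurableSet_Ioi fun u hu => by
    have : (0 : ℝ) < u := hu
    positivity
  have hIneg : ∀ n, I (-n) = I n := fun n => by simp [hI]
  set b : ℤ → ℝ := Set.indicator {n : ℤ | n ≠ 0} fun n => c n ^ 2 * I n with hb
  have hb0 : ∀ n, 0 ≤ b n :=
    Set.indicator_nonneg fun n _ => mul_nonneg (sq_nonneg _) (hI0 n)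
  have hsum' : HasSum (fun n => b n + b (-n)) L := by
    refine hsum.congr_fun fun n => ?_
    rcases eq_or_ne n 0 with rfl | hn
    · simp [hb, hzero]
    · rw [← fourierBasisFun_coeff_sq_add_neg hc hn]
      simp only [hb, Set.indicator, Set.mem_ofPred_eq, neg_ne_zero, ne_eq, hn, not_false_eq_true,
        if_true, hIneg]
      ring
  have hbs : Summable b := hsum'.summable.of_nonneg_of_le hb0 fun n =>
    le_add_of_nonneg_right (hb0 _)
  have hbn : HasSum (fun n => b (-n)) (∑' n, b n) := (Equiv.neg ℤ).hasSum_iff.mpr hbs.hasSum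
  have hLb : L = ∑' n, b n + ∑' n, b n := hsum'.unique (hbs.hasSum.add hbn)
  have htsum : ∑' n : {n : ℤ // n ≠ 0}, c n ^ 2 * I n = ∑' n, b n :=
    tsum_subtype {n : ℤ | n ≠ 0} fun n => c n ^ 2 * I n
  rw [htsum, hLb]
  ring
end

section
/- Let α > 0 and H ∈ (1/2, 1) be real numbers. Then sup_{T > 0} ∫₀^T ∫₀^T e^{−α(T−u)} e^{−α(T−v)} |u−v|^{2H−2} du dv < ∞; equivalently, the integral ∫₀^∞ ∫₀^∞ e^{−α u} e^{−α v} |u−v|^{2H−2} du dv is finite. -/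
open Real MeasureTheory

/-- The singular kernel `|t| ^ s`, cut off at `|t| = 1`, is integrable when `-1 < s`. -/
lemma integrable_indicator_abs_rpow {s : ℝ} (hs : -1 < s) :
    Integrable ((Set.Ioc (-1 : ℝ) 1).indicator fun t : ℝ => |t| ^ s) := by
  rw [integrable_indicator_iff measurableSet_Ioc,
    ← intervalIntegrable_iff_integrableOn_Ioc_of_le (by norm_num)]
  have hpos : IntervalIntegrable (fun t : ℝ => |t| ^ s) volume 0 1 := by
    refine (intervalIntegral.intervalIntegrable_rpow' hs (a := 0) (b := 1)).congr ?_
    intro t ht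
    rw [Set.uIoc_of_le zero_le_one] at ht
    simp only [abs_of_pos ht.1]
  have hneg : IntervalIntegrable (fun t : ℝ => |t| ^ s) volume (-1) 0 := by
    have h := hpos.comp_sub_left 0
    simp only [zero_sub, abs_neg, neg_zero] at h
    exact h.symm
  exact hneg.trans hpos

lemma integrableOn_exp_mul_exp_mul_abs_sub_rpow {α s : ℝ} (hα : 0 < α) (hs : -1 < s)
    (hs' : s ≤ 0) :
    IntegrableOn
      (fun p : ℝ × ℝ => Real.exp (-α * p.1) * Real.exp (-α * p.2) * |p.1 - p.2| ^ s)
      (Set.Ioi (0 : ℝ) ×ˢ Set.Ioi (0 : ℝ)) := by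
  have hexp : IntegrableOn (fun t : ℝ => Real.exp (-α * t)) (Set.Ioi 0) :=
    integrableOn_exp_mul_Ioi (neg_lt_zero.2 hα) 0
  have hnear : Integrable (fun p : ℝ × ℝ =>
      (Set.Ioi (0 : ℝ)).indicator (fun t => Real.exp (-α * t)) p.2 *
        (Set.Ioc (-1 : ℝ) 1).indicator (fun t => |t| ^ s) (p.1 - p.2)) :=
    ((integrable_indicator_iff measurableSet_Ioi).2 hexp).convolution_integrand
      (ContinuousLinearMap.mul ℝ ℝ) (integrable_indicator_abs_rpow hs)
  have hfar : IntegrableOn (fun p : ℝ × ℝ => Real.exp (-α * p.1) * Real.exp (-α * p.2))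
      (Set.Ioi (0 : ℝ) ×ˢ Set.Ioi (0 : ℝ)) := by
    rw [IntegrableOn, Measure.volume_eq_prod, ← Measure.prod_restrict]
    exact hexp.mul_prod hexp
  refine Integrable.mono' (hnear.integrableOn.add hfar)
    (Measurable.aestronglyMeasurable (by fun_prop)) ?_
  filter_upwards [ae_restrict_mem (measurableSet_Ioi.prod measurableSet_Ioi)] with p hp
  obtain ⟨hu, hv⟩ : 0 < p.1 ∧ 0 < p.2 := hp
  have hle : Real.exp (-α * p.1) ≤ 1 := Real.exp_le_one_iff.2 (by nlinarith)
  have hk : 0 ≤ |p.1 - p.2| ^ s := by positivity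
  rw [Real.norm_of_nonneg (by positivity)]
  simp only [Pi.add_apply]
  rw [Set.indicator_of_mem (Set.mem_Ioi.2 hv)]
  by_cases h : p.1 - p.2 ∈ Set.Ioc (-1 : ℝ) 1
  · rw [Set.indicator_of_mem h]
    calc Real.exp (-α * p.1) * Real.exp (-α * p.2) * |p.1 - p.2| ^ s
        ≤ 1 * Real.exp (-α * p.2) * |p.1 - p.2| ^ s := by gcongr
      _ ≤ _ := by rw [one_mul]; exact le_add_of_nonneg_right (by positivity)
  · rw [Set.indicator_of_notMem h, mul_zero, zero_add]
    refine mul_le_of_le_one_right (by positivity) (Real.rpow_le_one_of_one_le_of_nonpos ?_ hs')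
    rw [Set.mem_Ioc, not_and_or, not_lt, not_le] at h
    rcases h with h | h
    · exact le_abs.2 (Or.inr (by linarith))
    · exact le_abs.2 (Or.inl h.le)

theorem ou_double_integral_bounded (α H : ℝ) (hα : 0 < α)
    (hH : H ∈ Set.Ioo (1/2 : ℝ) 1) :
    (∃ C : ℝ, ∀ T : ℝ, 0 < T →
        (∫ u in (0:ℝ)..T, ∫ v in (0:ℝ)..T,
          Real.exp (-α * (T - u)) * Real.exp (-α * (T - v)) * |u - v| ^ (2 * H - 2)) ≤ C) ∧
      IntegrableOn
        (fun p : ℝ × ℝ =>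
          Real.exp (-α * p.1) * Real.exp (-α * p.2) * |p.1 - p.2| ^ (2 * H - 2))
        (Set.Ioi (0:ℝ) ×ˢ Set.Ioi (0:ℝ)) := by
  obtain ⟨hH₁, hH₂⟩ := hH
  have hint := integrableOn_exp_mul_exp_mul_abs_sub_rpow hα
    (show -1 < 2 * H - 2 by linarith) (by linarith)
  set F : ℝ × ℝ → ℝ := fun p =>
    Real.exp (-α * p.1) * Real.exp (-α * p.2) * |p.1 - p.2| ^ (2 * H - 2) with hF
  refine ⟨⟨∫ p in Set.Ioi (0 : ℝ) ×ˢ Set.Ioi (0 : ℝ), F p, fun T hT => ?_⟩, hint⟩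
  have hsub : Set.Ioc 0 T ×ˢ Set.Ioc 0 T ⊆ Set.Ioi (0 : ℝ) ×ˢ Set.Ioi (0 : ℝ) :=
    Set.prod_mono Set.Ioc_subset_Ioi_self Set.Ioc_subset_Ioi_self
  calc (∫ u in (0:ℝ)..T, ∫ v in (0:ℝ)..T,
          Real.exp (-α * (T - u)) * Real.exp (-α * (T - v)) * |u - v| ^ (2 * H - 2))
      = ∫ u in (0:ℝ)..T, ∫ v in (0:ℝ)..T, F (T - u, T - v) := by
        simp only [hF, sub_sub_sub_cancel_left, abs_sub_comm]
    _ = ∫ u in (0:ℝ)..T, ∫ v in (0:ℝ)..T, F (u, v) := by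
        have inner (x : ℝ) : ∫ v in (0:ℝ)..T, F (x, T - v) = ∫ v in (0:ℝ)..T, F (x, v) := by
          simpa using intervalIntegral.integral_comp_sub_left (a := 0) (b := T)
            (fun v => F (x, v)) T
        simp only [inner]
        simpa using intervalIntegral.integral_comp_sub_left (a := 0) (b := T)
          (fun u => ∫ v in (0:ℝ)..T, F (u, v)) T
    _ = ∫ p in Set.Ioc 0 T ×ˢ Set.Ioc 0 T, F p := by
        simp only [intervalIntegral.integral_of_le hT.le]
        exact (setIntegral_prod F (hint.mono_set hsub)).symm
    _ ≤ ∫ p in Set.Ioi (0 : ℝ) ×ˢ Set.Ioi (0 : ℝ), F p :=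
        setIntegral_mono_set hint (Filter.Eventually.of_forall fun p => by
          simp only [hF, Pi.zero_apply]; positivity) hsub.eventuallyLE
end

section
/- Let α > 0 and H ∈ (1/2, 1) be real numbers. There exists a constant C > 0 such that for all integers n ≥ 1, n^{−H} e^{−α n} ∫₀^n ∫₀^n e^{α v} |u−v|^{2H−2} du dv ≤ C·n^{H−1}. In particular, n^{−H} e^{−α n} ∫₀^n ∫₀^n e^{α v} |u−v|^{2H−2} du dv → 0 as n → ∞. -/
open Real MeasureTheory Filter

/-- The integral of `|u - v| ^ p` over an interval containing `v`, together with integrability. -/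
lemma integrable_and_integral_abs_sub_rpow {p a b v : ℝ} (hp : -1 < p) (ha : a ≤ v) (hb : v ≤ b) :
    IntervalIntegrable (fun u : ℝ => |u - v| ^ p) volume a b ∧
      ∫ u in a..b, |u - v| ^ p = ((v - a) ^ (p + 1) + (b - v) ^ (p + 1)) / (p + 1) := by
  have hp0 : p + 1 ≠ 0 := by linarith
  have hl : Set.EqOn (fun u : ℝ => (v - u) ^ p) (fun u => |u - v| ^ p) (Set.uIcc a v) := by
    intro u hu
    rw [Set.uIcc_of_le ha] at hu
    simp only
    rw [abs_sub_comm, abs_of_nonneg (sub_nonneg.2 hu.2)]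
  have hr : Set.EqOn (fun u : ℝ => (u - v) ^ p) (fun u => |u - v| ^ p) (Set.uIcc v b) := by
    intro u hu
    rw [Set.uIcc_of_le hb] at hu
    simp only
    rw [abs_of_nonneg (sub_nonneg.2 hu.1)]
  have il : IntervalIntegrable (fun u : ℝ => |u - v| ^ p) volume a v := by
    have h := (intervalIntegral.intervalIntegrable_rpow' hp (a := v - a) (b := 0)).comp_sub_left v
    simp only [sub_sub_cancel, sub_zero] at h
    exact h.congr fun u hu => hl (Set.uIoc_subset_uIcc hu)
  have ir : IntervalIntegrable (fun u : ℝ => |u - v| ^ p) volume v b := by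
    have h := (intervalIntegral.intervalIntegrable_rpow' hp (a := 0) (b := b - v)).comp_sub_right v
    simp only [sub_add_cancel, zero_add] at h
    exact h.congr fun u hu => hr (Set.uIoc_subset_uIcc hu)
  refine ⟨il.trans ir, ?_⟩
  rw [← intervalIntegral.integral_add_adjacent_intervals il ir,
    ← intervalIntegral.integral_congr hl, ← intervalIntegral.integral_congr hr,
    intervalIntegral.integral_comp_sub_left (fun x : ℝ => x ^ p),
    intervalIntegral.integral_comp_sub_right (fun x : ℝ => x ^ p),
    integral_rpow (Or.inl hp), integral_rpow (Or.inl hp), sub_self, zero_rpow hp0]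
  ring

lemma integral_exp_mul_abs_sub_rpow_le {α p b : ℝ} (hα : 0 < α) (hp : -1 < p) (hb : 0 ≤ b) :
    ∫ u in (0:ℝ)..b, ∫ v in (0:ℝ)..b, exp (α * v) * |u - v| ^ p ≤
      2 / (α * (p + 1)) * (b ^ (p + 1) * exp (α * b)) := by
  have hp1 : 0 < p + 1 := by linarith
  have key : ∀ v ∈ Set.Icc 0 b, ∫ u in (0:ℝ)..b, exp (α * v) * |u - v| ^ p =
      exp (α * v) * ((v ^ (p + 1) + (b - v) ^ (p + 1)) / (p + 1)) := by
    intro v hv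
    rw [intervalIntegral.integral_const_mul,
      (integrable_and_integral_abs_sub_rpow hp hv.1 hv.2).2, sub_zero]
  have hcont : Continuous fun v : ℝ =>
      exp (α * v) * ((v ^ (p + 1) + (b - v) ^ (p + 1)) / (p + 1)) := by
    have h1 : Continuous fun v : ℝ => v ^ (p + 1) := continuous_rpow_const hp1.le
    have h2 : Continuous fun v : ℝ => (b - v) ^ (p + 1) := h1.comp (continuous_const.sub continuous_id)
    fun_prop
  have hint : Integrable (Function.uncurry fun v u : ℝ => exp (α * v) * |u - v| ^ p)
      ((volume.restrict (Set.Ioc 0 b)).prod (volume.restrict (Set.Ioc 0 b))) := by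
    have hm : Measurable (Function.uncurry fun v u : ℝ => exp (α * v) * |u - v| ^ p) := by
      unfold Function.uncurry
      fun_prop
    rw [integrable_prod_iff hm.aestronglyMeasurable]
    constructor
    · filter_upwards [ae_restrict_mem measurableSet_Ioc] with v hv
      have h := (integrable_and_integral_abs_sub_rpow hp hv.1.le hv.2).1.const_mul (exp (α * v))
      exact (intervalIntegrable_iff_integrableOn_Ioc_of_le hb).1 h
    · refine ((hcont.integrableOn_Icc (a := 0) (b := b)).mono_set
        Set.Ioc_subset_Icc_self).integrable.congr ?_
      filter_upwards [ae_restrict_mem measurableSet_Ioc] with v hv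
      rw [← key v (Set.Ioc_subset_Icc_self hv), intervalIntegral.integral_of_le hb]
      refine integral_congr_ae (Eventually.of_forall fun u => ?_)
      exact (norm_of_nonneg (by positivity : 0 ≤ exp (α * v) * |u - v| ^ p)).symm
  have hswap : ∫ u in (0:ℝ)..b, ∫ v in (0:ℝ)..b, exp (α * v) * |u - v| ^ p =
      ∫ v in (0:ℝ)..b, ∫ u in (0:ℝ)..b, exp (α * v) * |u - v| ^ p := by
    simp only [intervalIntegral.integral_of_le hb]
    exact (integral_integral_swap hint).symm
  rw [hswap]
  have hexp : ∫ v in (0:ℝ)..b, exp (α * v) = (exp (α * b) - 1) / α := by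
    rw [intervalIntegral.integral_comp_mul_left (fun x => exp x) hα.ne', integral_exp]
    simp [div_eq_inv_mul]
  calc ∫ v in (0:ℝ)..b, ∫ u in (0:ℝ)..b, exp (α * v) * |u - v| ^ p
      = ∫ v in (0:ℝ)..b, exp (α * v) * ((v ^ (p + 1) + (b - v) ^ (p + 1)) / (p + 1)) :=
        intervalIntegral.integral_congr fun v hv => key v (by rwa [Set.uIcc_of_le hb] at hv)
    _ ≤ ∫ v in (0:ℝ)..b, exp (α * v) * ((b ^ (p + 1) + b ^ (p + 1)) / (p + 1)) := by
        refine intervalIntegral.integral_mono_on hb (hcont.intervalIntegrable _ _)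
          (Continuous.intervalIntegrable (by fun_prop) _ _) fun v hv => ?_
        have h1 : v ^ (p + 1) ≤ b ^ (p + 1) := rpow_le_rpow hv.1 hv.2 hp1.le
        have h2 : (b - v) ^ (p + 1) ≤ b ^ (p + 1) :=
          rpow_le_rpow (sub_nonneg.2 hv.2) (sub_le_self _ hv.1) hp1.le
        gcongr
    _ = 2 / (α * (p + 1)) * (b ^ (p + 1) * (exp (α * b) - 1)) := by
        rw [intervalIntegral.integral_mul_const, hexp]
        field_simp
        ring
    _ ≤ 2 / (α * (p + 1)) * (b ^ (p + 1) * exp (α * b)) := by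
        have : exp (α * b) - 1 ≤ exp (α * b) := by linarith
        gcongr

theorem exp_kernel_double_integral_decay (α H : ℝ) (hα : 0 < α)
    (hH : H ∈ Set.Ioo (1/2 : ℝ) 1) :
    (∃ C : ℝ, 0 < C ∧ ∀ n : ℕ, 1 ≤ n →
        (n : ℝ) ^ (-H) * Real.exp (-α * n) *
            (∫ u in (0:ℝ)..(n:ℝ), ∫ v in (0:ℝ)..(n:ℝ),
              Real.exp (α * v) * |u - v| ^ (2 * H - 2))
          ≤ C * (n : ℝ) ^ (H - 1)) ∧
    Tendsto
      (fun n : ℕ =>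
        (n : ℝ) ^ (-H) * Real.exp (-α * n) *
          ∫ u in (0:ℝ)..(n:ℝ), ∫ v in (0:ℝ)..(n:ℝ),
            Real.exp (α * v) * |u - v| ^ (2 * H - 2))
      atTop (nhds 0) := by
  obtain ⟨hH1, hH2⟩ := hH
  have hp : -1 < 2 * H - 2 := by linarith
  have hp1 : 0 < 2 * H - 2 + 1 := by linarith
  have bound : ∀ n : ℕ, 1 ≤ n →
      (n : ℝ) ^ (-H) * exp (-α * n) *
          (∫ u in (0:ℝ)..(n:ℝ), ∫ v in (0:ℝ)..(n:ℝ), exp (α * v) * |u - v| ^ (2 * H - 2))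
        ≤ 2 / (α * (2 * H - 2 + 1)) * (n : ℝ) ^ (H - 1) := by
    intro n hn
    have hn0 : (0 : ℝ) < n := by exact_mod_cast hn
    have hpow : (n : ℝ) ^ (H - 1) = (n : ℝ) ^ (-H) * (n : ℝ) ^ (2 * H - 2 + 1) := by
      rw [← rpow_add hn0]
      ring_nf
    have hexp : exp (-α * n) * exp (α * n) = 1 := by
      rw [← exp_add]
      simp
    calc _ ≤ (n : ℝ) ^ (-H) * exp (-α * n) * (2 / (α * (2 * H - 2 + 1)) *
            ((n : ℝ) ^ (2 * H - 2 + 1) * exp (α * n))) := by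
          gcongr
          exact integral_exp_mul_abs_sub_rpow_le hα hp hn0.le
      _ = 2 / (α * (2 * H - 2 + 1)) * ((n : ℝ) ^ (-H) * (n : ℝ) ^ (2 * H - 2 + 1)) *
            (exp (-α * n) * exp (α * n)) := by ring
      _ = _ := by rw [hexp, mul_one, hpow]
  refine ⟨⟨_, by positivity, bound⟩, ?_⟩
  have hlim : Tendsto (fun n : ℕ => 2 / (α * (2 * H - 2 + 1)) * (n : ℝ) ^ (H - 1))
      atTop (nhds 0) := by
    have h := (tendsto_rpow_neg_atTop (sub_pos.2 hH2)).comp (tendsto_natCast_atTop_atTop (R := ℝ))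
    simpa [Function.comp_def] using h.const_mul (2 / (α * (2 * H - 2 + 1)))
  refine squeeze_zero' (Eventually.of_forall fun n => ?_)
    ((eventually_ge_atTop 1).mono bound) hlim
  have hn0 : (0 : ℝ) ≤ n := n.cast_nonneg
  refine mul_nonneg (by positivity) (intervalIntegral.integral_nonneg hn0 fun u _ =>
    intervalIntegral.integral_nonneg hn0 fun v _ => by positivity)
end
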